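/- arXiv:1409.6409 — 8 statements merged into one kernel-verified Lean document; each statement's English description precedes it below -/
import Mathlib

section
/- If R is invertible and X is a symmetric solution of CGDARE(Σ), then the matrix R_X = R + Bᵀ X B is invertible. -/
open Matrix

/-- `Md` satisfies the four Penrose equations for `M`, i.e. it is the
Moore–Penrose pseudoinverse `M†` of `M`. -/
def IsMP {p q : ℕ} (M : Matrix (Fin p) (Fin q) ℝ) (Md : Matrix (Fin q) (Fin p) ℝ) : Prop :=
  M * Md * M = M ∧ Md * M * Md = Md ∧ (M * Md)ᵀ = M * Md ∧ (Md * M)ᵀ = Md * M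

/-- A function that does not increase along `x ↦ M x + a u`, for every scalar `a`, does not increase
from `u` to `p(M) u` when `p` is monic. -/
theorem le_of_monic_aeval {n : ℕ} (M : Matrix (Fin n) (Fin n) ℝ) (u : Fin n → ℝ)
    (V : (Fin n → ℝ) → ℝ) (hV : ∀ (x : Fin n → ℝ) (a : ℝ), V (M *ᵥ x + a • u) ≤ V x)
    (p : Polynomial ℝ) (hp : p.Monic) : V (Polynomial.aeval M p *ᵥ u) ≤ V u := by
  induction hd : p.natDegree generalizing p with
  | zero =>
    rw [hp.natDegree_eq_zero.mp hd]
    simp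
  | succ d ih =>
    have hq : p.divX.natDegree = d := by
      rw [Polynomial.natDegree_divX_eq_natDegree_tsub_one, hd, Nat.add_sub_cancel]
    have hqm : p.divX.Monic := by
      rw [Polynomial.Monic, Polynomial.leadingCoeff, hq, Polynomial.coeff_divX, ← hd]
      exact hp
    have hstep : Polynomial.aeval M p *ᵥ u =
        M *ᵥ (Polynomial.aeval M p.divX *ᵥ u) + p.coeff 0 • u := by
      conv_lhs => rw [← Polynomial.X_mul_divX_add p]
      rw [map_add, map_mul, Polynomial.aeval_X, Polynomial.aeval_C, add_mulVec, mulVec_mulVec,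
        Algebra.algebraMap_eq_smul_one, smul_mulVec, one_mulVec]
    rw [hstep]
    exact (hV _ _).trans (ih _ hqm hq)

/-- If the columns of `N` vanish on the kernel of a symmetric `M`, then `M M†` fixes `Nᵀ`. -/
theorem IsMP.mul_mul_transpose {n m : ℕ} {M Md : Matrix (Fin m) (Fin m) ℝ} (h : IsMP M Md)
    (hM : Mᵀ = M) {N : Matrix (Fin n) (Fin m) ℝ}
    (hker : LinearMap.ker M.mulVecLin ≤ LinearMap.ker N.mulVecLin) : M * (Md * Nᵀ) = Nᵀ := by
  have hN : N * Md * M = N := by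
    refine ext_of_mulVec_single fun i => ?_
    have hx : Md *ᵥ (M *ᵥ Pi.single i 1) - Pi.single i 1 ∈ LinearMap.ker M.mulVecLin := by
      rw [LinearMap.mem_ker, mulVecLin_apply, mulVec_sub, mulVec_mulVec, mulVec_mulVec,
        h.1, sub_self]
    have hy := hker hx
    rw [LinearMap.mem_ker, mulVecLin_apply, mulVec_sub, sub_eq_zero] at hy
    rw [← hy, mulVec_mulVec, mulVec_mulVec, Matrix.mul_assoc]
  have hNt : Nᵀ = M * (Mdᵀ * Nᵀ) := by
    conv_lhs => rw [← hN]
    rw [transpose_mul, transpose_mul, hM]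
  rw [hNt, ← Matrix.mul_assoc Md, ← Matrix.mul_assoc M, ← Matrix.mul_assoc M, h.1]

/-- Dissipation along a state-input pair satisfying the costate and stationarity equations. -/
theorem quadratic_cost_step_le {n m : ℕ} {A Q X : Matrix (Fin n) (Fin n) ℝ}
    {B S : Matrix (Fin n) (Fin m) ℝ} {R : Matrix (Fin m) (Fin m) ℝ}
    (hPi : (fromBlocks Q S Sᵀ R).PosSemidef) (x : Fin n → ℝ) (k : Fin m → ℝ)
    (hx : X *ᵥ x = Aᵀ *ᵥ (X *ᵥ (A *ᵥ x + B *ᵥ k)) + S *ᵥ k + Q *ᵥ x)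
    (hk : R *ᵥ k + Bᵀ *ᵥ (X *ᵥ (A *ᵥ x + B *ᵥ k)) + Sᵀ *ᵥ x = 0) :
    (A *ᵥ x + B *ᵥ k) ⬝ᵥ X *ᵥ (A *ᵥ x + B *ᵥ k) ≤ x ⬝ᵥ X *ᵥ x := by
  have hpos := hPi.dotProduct_mulVec_nonneg (Sum.elim x k)
  rw [fromBlocks_mulVec] at hpos
  simp only [star_trivial, Sum.elim_comp_inl, Sum.elim_comp_inr, sumElim_dotProduct_sumElim,
    dotProduct_add] at hpos
  have hk' := congrArg (fun w => k ⬝ᵥ w) hk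
  have adj : ∀ {p : ℕ} (C : Matrix (Fin n) (Fin p) ℝ) (a : Fin p → ℝ) (b : Fin n → ℝ),
      a ⬝ᵥ Cᵀ *ᵥ b = (C *ᵥ a) ⬝ᵥ b := fun C a b => by
    rw [dotProduct_mulVec, vecMul_transpose]
  simp only [dotProduct_add, dotProduct_zero, adj B] at hk'
  rw [hx, dotProduct_add, dotProduct_add, adj A, add_dotProduct]
  linarith

/-- If `R` is invertible and `X` is a symmetric solution of CGDARE(Σ),
then `R_X = R + Bᵀ X B` is invertible. -/
theorem stmt0 {n m : ℕ} (hn : 0 < n) (hm : 0 < m)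
    (A : Matrix (Fin n) (Fin n) ℝ) (B : Matrix (Fin n) (Fin m) ℝ)
    (Q : Matrix (Fin n) (Fin n) ℝ) (S : Matrix (Fin n) (Fin m) ℝ)
    (R : Matrix (Fin m) (Fin m) ℝ)
    (hQ : Qᵀ = Q) (hR : Rᵀ = R)
    (hPi : (fromBlocks Q S Sᵀ R).PosSemidef)
    (X : Matrix (Fin n) (Fin n) ℝ) (hX : Xᵀ = X)
    (RXd : Matrix (Fin m) (Fin m) ℝ) (hRXd : IsMP (R + Bᵀ * X * B) RXd)
    (heq : X = Aᵀ * X * A - (Aᵀ * X * B + S) * RXd * (Aᵀ * X * B + S)ᵀ + Q)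
    (hker : LinearMap.ker (R + Bᵀ * X * B).mulVecLin ≤
      LinearMap.ker (Aᵀ * X * B + S).mulVecLin)
    (hRinv : IsUnit R) :
    IsUnit (R + Bᵀ * X * B) := by
  set RX := R + Bᵀ * X * B with hRX
  set SX := Aᵀ * X * B + S with hSX
  have hRpsd : R.PosSemidef := by
    have := hPi.submatrix (Sum.inr : Fin m → Fin n ⊕ Fin m)
    exact this
  have hRpos : R.PosDef := hRpsd.posDef_iff_isUnit.mpr hRinv
  have hRXsymm : RXᵀ = RX := by
    rw [hRX, transpose_add, transpose_mul, transpose_mul, transpose_transpose, hR, hX,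
      Matrix.mul_assoc]
  have hfix := hRXd.mul_mul_transpose hRXsymm hker
  have hSXt : SXᵀ = Bᵀ * X * A + Sᵀ := by
    rw [hSX, transpose_add, transpose_mul, transpose_mul, transpose_transpose, hX,
      Matrix.mul_assoc]
  rw [← mulVec_injective_iff_isUnit, ← coe_mulVecLin, ← LinearMap.ker_eq_bot, LinearMap.ker_eq_bot']
  intro v hv
  have hSv : SX *ᵥ v = 0 := hker hv
  rw [mulVecLin_apply] at hv
  have hstep : ∀ (x : Fin n → ℝ) (a : ℝ),
      ((A - B * (RXd * SXᵀ)) *ᵥ x + a • B *ᵥ v) ⬝ᵥ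
        X *ᵥ ((A - B * (RXd * SXᵀ)) *ᵥ x + a • B *ᵥ v) ≤ x ⬝ᵥ X *ᵥ x := by
    intro x a
    set k := a • v - (RXd * SXᵀ) *ᵥ x with hk
    have hy : (A - B * (RXd * SXᵀ)) *ᵥ x + a • B *ᵥ v = A *ᵥ x + B *ᵥ k := by
      rw [hk, mulVec_sub, sub_mulVec, mulVec_smul, mulVec_mulVec]
      abel
    have hRk : RX *ᵥ k = -(SXᵀ *ᵥ x) := by
      rw [hk, mulVec_sub, mulVec_smul, hv, mulVec_mulVec, hfix, smul_zero, zero_sub]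
    have hSk : SX *ᵥ k = -((SX * RXd * SXᵀ) *ᵥ x) := by
      rw [hk, mulVec_sub, mulVec_smul, hSv, mulVec_mulVec, smul_zero, zero_sub, Matrix.mul_assoc]
    rw [hy]
    refine quadratic_cost_step_le hPi x k ?_ ?_
    · conv_lhs => rw [heq, add_mulVec, sub_mulVec, sub_eq_add_neg, ← hSk, hSX]
      simp only [mulVec_add, mulVec_mulVec, add_mulVec, Matrix.mul_assoc]
      abel
    · rw [hSXt, hRX] at hRk
      rw [← sub_eq_zero, sub_neg_eq_add] at hRk
      rw [← hRk]
      simp only [mulVec_add, mulVec_mulVec, add_mulVec, Matrix.mul_assoc]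
      abel
  have hle := le_of_monic_aeval (A - B * (RXd * SXᵀ)) (B *ᵥ v) (fun x => x ⬝ᵥ X *ᵥ x) hstep
    _ (charpoly_monic (A - B * (RXd * SXᵀ)))
  rw [aeval_self_charpoly, zero_mulVec, zero_dotProduct] at hle
  have hv0 : v ⬝ᵥ R *ᵥ v + (B *ᵥ v) ⬝ᵥ X *ᵥ (B *ᵥ v) = 0 := by
    have := congrArg (fun w => v ⬝ᵥ w) hv
    simp only [hRX, add_mulVec, dotProduct_add, dotProduct_zero] at this
    rw [← this, ← mulVec_mulVec, ← mulVec_mulVec, dotProduct_mulVec v Bᵀ, vecMul_transpose]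
  by_contra hne
  have := hRpos.dotProduct_mulVec_pos hne
  rw [star_trivial] at this
  linarith
end

section
/- A symmetric matrix X ∈ ℝ^{n×n} is a solution of CGDARE(Σ) if and only if it is a solution of CGDARE(Σ₀), i.e. if and only if X = A₀ᵀ X A₀ − A₀ᵀ X B (R + Bᵀ X B)† Bᵀ X A₀ + Q₀ and ker(R + Bᵀ X B) ⊆ ker(A₀ᵀ X B). -/
open Matrix

/-- In a positive semidefinite block matrix, the kernel of the lower right block is contained
in the kernel of the upper right block. -/
theorem ker_le_ker_of_posSemidef_fromBlocks {n m : ℕ}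
    {Q : Matrix (Fin n) (Fin n) ℝ} {S : Matrix (Fin n) (Fin m) ℝ} {R : Matrix (Fin m) (Fin m) ℝ}
    (h : (fromBlocks Q S Sᵀ R).PosSemidef) :
    LinearMap.ker R.mulVecLin ≤ LinearMap.ker S.mulVecLin := by
  intro v hv
  simp only [LinearMap.mem_ker, mulVecLin_apply] at hv ⊢
  have key := (h.dotProduct_mulVec_zero_iff (Sum.elim 0 v)).1 (by
    simp [fromBlocks_mulVec, hv, dotProduct])
  ext i
  simpa [fromBlocks_mulVec] using congrFun key (Sum.inl i)

/-- If `ker M ⊆ ker T` and `G` is an inner inverse of `M`, then `G * M` can be cancelled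
to the right of `T`. -/
theorem mul_mul_eq_self_of_ker_le_ker {p q r : ℕ} {M : Matrix (Fin p) (Fin q) ℝ}
    {G : Matrix (Fin q) (Fin p) ℝ} {T : Matrix (Fin r) (Fin q) ℝ} (hG : M * G * M = M)
    (h : LinearMap.ker M.mulVecLin ≤ LinearMap.ker T.mulVecLin) : T * G * M = T := by
  refine ext_of_mulVec_single fun i => ?_
  set v : Fin q → ℝ := Pi.single i 1
  have hv : v - (G * M) *ᵥ v ∈ LinearMap.ker M.mulVecLin := by
    rw [LinearMap.mem_ker, mulVecLin_apply, mulVec_sub, mulVec_mulVec, ← Matrix.mul_assoc, hG,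
      sub_self]
  have hT := h hv
  rw [LinearMap.mem_ker, mulVecLin_apply, mulVec_sub, mulVec_mulVec, ← Matrix.mul_assoc,
    sub_eq_zero] at hT
  exact hT.symm

/-- The transposed cancellation for symmetric `M`. -/
theorem mul_mul_transpose_eq_of_ker_le_ker {p r : ℕ} {M G : Matrix (Fin p) (Fin p) ℝ}
    {T : Matrix (Fin r) (Fin p) ℝ} (hM : Mᵀ = M) (hG : M * G * M = M)
    (h : LinearMap.ker M.mulVecLin ≤ LinearMap.ker T.mulVecLin) : M * G * Tᵀ = Tᵀ := by
  have hT : M * (Gᵀ * Tᵀ) = Tᵀ := by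
    simpa [hM, Matrix.mul_assoc] using
      congrArg transpose (mul_mul_eq_self_of_ker_le_ker hG h)
  rw [← hT, ← Matrix.mul_assoc, hG]

/-- Adding a left multiple of `M` does not affect whether the kernel of `M` is contained
in a given kernel. -/
theorem ker_le_ker_add_mul_iff {p q r : ℕ} (M : Matrix (Fin p) (Fin q) ℝ)
    (T : Matrix (Fin r) (Fin q) ℝ) (L : Matrix (Fin r) (Fin p) ℝ) :
    LinearMap.ker M.mulVecLin ≤ LinearMap.ker (T + L * M).mulVecLin ↔
      LinearMap.ker M.mulVecLin ≤ LinearMap.ker T.mulVecLin := by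
  refine forall₂_congr fun v hv => ?_
  rw [LinearMap.mem_ker, mulVecLin_apply] at hv
  simp [hv]

/-- A symmetric `X` solves CGDARE(Σ) iff it solves CGDARE(Σ₀), where
`A₀ = A − B R† Sᵀ` and `Q₀ = Q − S R† Sᵀ`. -/
theorem stmt3 {n m : ℕ} (hn : 0 < n) (hm : 0 < m)
    (A : Matrix (Fin n) (Fin n) ℝ) (B : Matrix (Fin n) (Fin m) ℝ)
    (Q : Matrix (Fin n) (Fin n) ℝ) (S : Matrix (Fin n) (Fin m) ℝ)
    (R : Matrix (Fin m) (Fin m) ℝ)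
    (hQ : Qᵀ = Q) (hR : Rᵀ = R)
    (hPi : (fromBlocks Q S Sᵀ R).PosSemidef)
    (Rd : Matrix (Fin m) (Fin m) ℝ) (hRd : IsMP R Rd)
    (A0 Q0 : Matrix (Fin n) (Fin n) ℝ)
    (hA0 : A0 = A - B * Rd * Sᵀ) (hQ0 : Q0 = Q - S * Rd * Sᵀ)
    (X : Matrix (Fin n) (Fin n) ℝ) (hX : Xᵀ = X)
    (RXd : Matrix (Fin m) (Fin m) ℝ) (hRXd : IsMP (R + Bᵀ * X * B) RXd) :
    (X = Aᵀ * X * A - (Aᵀ * X * B + S) * RXd * (Aᵀ * X * B + S)ᵀ + Q ∧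
      LinearMap.ker (R + Bᵀ * X * B).mulVecLin ≤
        LinearMap.ker (Aᵀ * X * B + S).mulVecLin) ↔
    (X = A0ᵀ * X * A0 - A0ᵀ * X * B * RXd * (Bᵀ * X * A0) + Q0 ∧
      LinearMap.ker (R + Bᵀ * X * B).mulVecLin ≤
        LinearMap.ker (A0ᵀ * X * B).mulVecLin) := by
  obtain ⟨hRd, -⟩ := hRd
  obtain ⟨hG, -⟩ := hRXd
  have hRK : R * Rd * Sᵀ = Sᵀ :=
    mul_mul_transpose_eq_of_ker_le_ker hR hRd (ker_le_ker_of_posSemidef_fromBlocks hPi)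
  obtain ⟨K, hK⟩ : ∃ K, K = Rd * Sᵀ := ⟨_, rfl⟩
  have hSt : Sᵀ = R * K := by rw [hK, ← Matrix.mul_assoc, hRK]
  have hS : S = Kᵀ * R := by rw [← transpose_transpose S, hSt, transpose_mul, hR]
  have hA : A = A0 + B * K := by rw [hA0, hK, Matrix.mul_assoc]; abel
  have hQ' : Q = Q0 + Kᵀ * R * K := by
    rw [hQ0, Matrix.mul_assoc S, ← hK, ← hS]; abel
  obtain ⟨M, hM⟩ : ∃ M, M = R + Bᵀ * X * B := ⟨_, rfl⟩
  have hMt : Mᵀ = M := by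
    simp [hM, hR, hX, Matrix.mul_assoc]
  obtain ⟨T, hT⟩ : ∃ T, T = A0ᵀ * X * B := ⟨_, rfl⟩
  have hTt : Bᵀ * X * A0 = Tᵀ := by simp [hT, hX, Matrix.mul_assoc]
  have hSX : Aᵀ * X * B + S = T + Kᵀ * M := by
    rw [hA, hS, hT, hM]
    simp only [transpose_add, transpose_mul, Matrix.add_mul, Matrix.mul_add, Matrix.mul_assoc]
    abel
  rw [hSX, hTt, ← hT, ← hM, ker_le_ker_add_mul_iff]
  rw [← hM] at hG
  refine and_congr_left fun hker => ?_
  have hTG := mul_mul_eq_self_of_ker_le_ker hG hker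
  have hGT := mul_mul_transpose_eq_of_ker_le_ker hMt hG hker
  have hquad : (T + Kᵀ * M) * RXd * (T + Kᵀ * M)ᵀ =
      T * RXd * Tᵀ + T * K + Kᵀ * Tᵀ + Kᵀ * M * K := by
    calc (T + Kᵀ * M) * RXd * (T + Kᵀ * M)ᵀ
        = T * RXd * Tᵀ + T * RXd * M * K + Kᵀ * (M * RXd * Tᵀ) + Kᵀ * (M * RXd * M) * K := by
          simp only [transpose_add, transpose_mul, transpose_transpose, hMt, Matrix.add_mul,
            Matrix.mul_add, Matrix.mul_assoc]
          abel
      _ = _ := by rw [hTG, hGT, hG]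
  have hAXA : Aᵀ * X * A = A0ᵀ * X * A0 + T * K + Kᵀ * Tᵀ + Kᵀ * (Bᵀ * X * B) * K := by
    rw [← hTt, hT, hA]
    simp only [transpose_add, transpose_mul, Matrix.add_mul, Matrix.mul_add, Matrix.mul_assoc]
    abel
  have hrhs : Aᵀ * X * A - (T + Kᵀ * M) * RXd * (T + Kᵀ * M)ᵀ + Q =
      A0ᵀ * X * A0 - T * RXd * Tᵀ + Q0 := by
    rw [hquad, hAXA, hQ', hM, Matrix.mul_add, Matrix.add_mul]
    abel
  rw [hrhs]
end

section
/- For every symmetric solution X of CGDARE(Σ), the closed-loop matrix A_X = A − B R_X† S_Xᵀ satisfies A_X = A₀ − B (R + Bᵀ X B)† Bᵀ X A₀. -/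
open Matrix

/-- Along the dynamics `x ↦ F x + c b` with free scalar input `c`, a function that never increases
takes at any monic polynomial in `F` applied to `b` at most its value at `b`. -/
lemma apply_aeval_mulVec_le_of_monic {ι : Type*} [Fintype ι] [DecidableEq ι]
    (V : (ι → ℝ) → ℝ) (F : Matrix ι ι ℝ) (b : ι → ℝ)
    (hV : ∀ (x : ι → ℝ) (c : ℝ), V (F *ᵥ x + c • b) ≤ V x) (d : ℕ) :
    ∀ p : Polynomial ℝ, p.Monic → p.natDegree = d → V (Polynomial.aeval F p *ᵥ b) ≤ V b := by
  induction d with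
  | zero =>
    intro p hp hd
    rw [hp.natDegree_eq_zero.mp hd]
    simp
  | succ d ih =>
    intro p hp hd
    have hdeg : p.divX.natDegree = d := by
      rw [Polynomial.natDegree_divX_eq_natDegree_tsub_one, hd, Nat.add_sub_cancel]
    have hmonic : p.divX.Monic := by
      rw [Polynomial.Monic, Polynomial.leadingCoeff, hdeg, Polynomial.coeff_divX, ← hd]
      exact hp
    have hstep : Polynomial.aeval F p *ᵥ b =
        F *ᵥ (Polynomial.aeval F p.divX *ᵥ b) + p.coeff 0 • b := by
      conv_lhs => rw [← Polynomial.X_mul_divX_add p]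
      rw [map_add, map_mul, Polynomial.aeval_X, Polynomial.aeval_C,
        Algebra.algebraMap_eq_smul_one, Matrix.add_mulVec, Matrix.mulVec_mulVec,
        Matrix.smul_mulVec, Matrix.one_mulVec]
    rw [hstep]
    exact (hV _ _).trans (ih _ hmonic hdeg)

lemma apply_zero_le_of_forall_apply_le {ι : Type*} [Fintype ι] [DecidableEq ι]
    (V : (ι → ℝ) → ℝ) (F : Matrix ι ι ℝ) (b : ι → ℝ)
    (hV : ∀ (x : ι → ℝ) (c : ℝ), V (F *ᵥ x + c • b) ≤ V x) : V 0 ≤ V b := by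
  have h := apply_aeval_mulVec_le_of_monic V F b hV _ F.charpoly F.charpoly_monic rfl
  rwa [Matrix.aeval_self_charpoly, Matrix.zero_mulVec] at h

lemma IsMP.mul_mul_eq_of_ker_le {p q r : ℕ} {M : Matrix (Fin p) (Fin q) ℝ}
    {Md : Matrix (Fin q) (Fin p) ℝ} (h : IsMP M Md) {N : Matrix (Fin r) (Fin q) ℝ}
    (hker : ∀ v, M *ᵥ v = 0 → N *ᵥ v = 0) : N * Md * M = N := by
  refine Matrix.ext_iff_mulVec.mpr fun v => ?_
  have h0 := hker (v - (Md * M) *ᵥ v) (by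
    rw [Matrix.mulVec_sub, Matrix.mulVec_mulVec, ← Matrix.mul_assoc, h.1, sub_self])
  rw [Matrix.mulVec_sub, Matrix.mulVec_mulVec, ← Matrix.mul_assoc, sub_eq_zero] at h0
  exact h0.symm

lemma IsMP.mul_mul_transpose_eq_of_ker_le {p r : ℕ} {M Md : Matrix (Fin p) (Fin p) ℝ}
    (h : IsMP M Md) (hM : Mᵀ = M) {N : Matrix (Fin r) (Fin p) ℝ}
    (hker : ∀ v, M *ᵥ v = 0 → N *ᵥ v = 0) : M * Md * Nᵀ = Nᵀ := by
  have hN : Nᵀ = M * (N * Md)ᵀ := by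
    conv_lhs => rw [← h.mul_mul_eq_of_ker_le hker, Matrix.transpose_mul, hM]
  rw [hN, ← Matrix.mul_assoc, h.1]

/-- A vector on which the quadratic form of the lower-right block is nonpositive is annihilated by
both right blocks of a positive semidefinite block matrix. -/
lemma Matrix.PosSemidef.mulVec_eq_zero_of_fromBlocks {n m : ℕ} {Q : Matrix (Fin n) (Fin n) ℝ}
    {S : Matrix (Fin n) (Fin m) ℝ} {R : Matrix (Fin m) (Fin m) ℝ}
    (h : (fromBlocks Q S Sᵀ R).PosSemidef) {w : Fin m → ℝ} (hw : w ⬝ᵥ (R *ᵥ w) ≤ 0) :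
    S *ᵥ w = 0 ∧ R *ᵥ w = 0 := by
  have hval : star (Sum.elim (0 : Fin n → ℝ) w) ⬝ᵥ
      (fromBlocks Q S Sᵀ R *ᵥ Sum.elim 0 w) = w ⬝ᵥ (R *ᵥ w) := by
    simp [Matrix.fromBlocks_mulVec]
  have h0 := h.dotProduct_mulVec_nonneg (Sum.elim (0 : Fin n → ℝ) w)
  rw [hval] at h0
  have h1 := (h.dotProduct_mulVec_zero_iff (Sum.elim (0 : Fin n → ℝ) w)).mp
    (hval.trans (le_antisymm hw h0))
  rw [Matrix.fromBlocks_mulVec] at h1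
  constructor
  · ext i
    simpa using congrFun h1 (Sum.inl i)
  · ext i
    simpa using congrFun h1 (Sum.inr i)

lemma mulVec_dotProduct_eq {p q : ℕ} (M : Matrix (Fin p) (Fin q) ℝ) (a : Fin q → ℝ)
    (b : Fin p → ℝ) : (M *ᵥ a) ⬝ᵥ b = a ⬝ᵥ (Mᵀ *ᵥ b) := by
  rw [Matrix.dotProduct_mulVec, Matrix.vecMul_transpose]

/-- Completion of the square for a feedback gain `K` solving the stationarity equation. -/
lemma quadratic_cost_eq_complete_square {n m : ℕ} {A Q X : Matrix (Fin n) (Fin n) ℝ}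
    {B S : Matrix (Fin n) (Fin m) ℝ} {R : Matrix (Fin m) (Fin m) ℝ} {K : Matrix (Fin m) (Fin n) ℝ}
    (hR : Rᵀ = R) (hX : Xᵀ = X) (hK : (R + Bᵀ * X * B) * K = (Aᵀ * X * B + S)ᵀ)
    (heq : X = Aᵀ * X * A - (Aᵀ * X * B + S) * K + Q) (x : Fin n → ℝ) (v : Fin m → ℝ) :
    Sum.elim x (v - K *ᵥ x) ⬝ᵥ (fromBlocks Q S Sᵀ R *ᵥ Sum.elim x (v - K *ᵥ x)) +
      (A *ᵥ x + B *ᵥ (v - K *ᵥ x)) ⬝ᵥ (X *ᵥ (A *ᵥ x + B *ᵥ (v - K *ᵥ x))) =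
    x ⬝ᵥ (X *ᵥ x) + v ⬝ᵥ ((R + Bᵀ * X * B) *ᵥ v) := by
  obtain ⟨u, hu⟩ : ∃ u, u = v - K *ᵥ x := ⟨_, rfl⟩
  obtain rfl : v = u + K *ᵥ x := by rw [hu, sub_add_cancel]
  rw [add_sub_cancel_right]
  have hKt : Kᵀ * (R + Bᵀ * X * B) = Aᵀ * X * B + S := by
    have := congrArg Matrix.transpose hK
    simpa [Matrix.transpose_mul, hR, hX, Matrix.mul_assoc] using this
  have hQ : Q = X - Aᵀ * X * A + (Aᵀ * X * B + S) * K := by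
    rw [eq_sub_of_add_eq' heq.symm]
    abel
  have hcost : Sum.elim x u ⬝ᵥ (fromBlocks Q S Sᵀ R *ᵥ Sum.elim x u) =
      x ⬝ᵥ (Q *ᵥ x) + x ⬝ᵥ (S *ᵥ u) + u ⬝ᵥ (Sᵀ *ᵥ x) + u ⬝ᵥ (R *ᵥ u) := by
    rw [Matrix.fromBlocks_mulVec, sumElim_dotProduct_sumElim]
    simp only [Sum.elim_comp_inl, Sum.elim_comp_inr, dotProduct_add]
    ring
  have hsq : (u + K *ᵥ x) ⬝ᵥ ((R + Bᵀ * X * B) *ᵥ (u + K *ᵥ x)) =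
      u ⬝ᵥ ((R + Bᵀ * X * B) *ᵥ u) + u ⬝ᵥ ((Aᵀ * X * B + S)ᵀ *ᵥ x) +
        x ⬝ᵥ ((Aᵀ * X * B + S) *ᵥ u) + x ⬝ᵥ (((Aᵀ * X * B + S) * K) *ᵥ x) := by
    have hKK : Kᵀ * (Aᵀ * X * B + S)ᵀ = (Aᵀ * X * B + S) * K := by
      rw [← hK, ← hKt, Matrix.mul_assoc Kᵀ]
    simp only [Matrix.mulVec_add _ u, add_dotProduct, dotProduct_add, mulVec_dotProduct_eq,
      Matrix.mulVec_mulVec]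
    rw [hK, hKt, hKK]
    ring
  rw [hcost, hsq, hQ]
  simp only [Matrix.mulVec_add, Matrix.add_mulVec, Matrix.sub_mulVec, add_dotProduct,
    dotProduct_add, dotProduct_sub, mulVec_dotProduct_eq, Matrix.mulVec_mulVec,
    Matrix.transpose_add, Matrix.transpose_mul, Matrix.transpose_transpose, hX, Matrix.mul_assoc]
  ring

/-- If `X` solves the Riccati equation with feedback gain `K`, then the kernel of
`R + Bᵀ X B` is contained in the kernel of `R`. -/
lemma mulVec_eq_zero_of_riccati {n m : ℕ} {A Q X : Matrix (Fin n) (Fin n) ℝ}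
    {B S : Matrix (Fin n) (Fin m) ℝ} {R : Matrix (Fin m) (Fin m) ℝ} {K : Matrix (Fin m) (Fin n) ℝ}
    (hPi : (fromBlocks Q S Sᵀ R).PosSemidef) (hR : Rᵀ = R) (hX : Xᵀ = X)
    (hK : (R + Bᵀ * X * B) * K = (Aᵀ * X * B + S)ᵀ)
    (heq : X = Aᵀ * X * A - (Aᵀ * X * B + S) * K + Q) {w : Fin m → ℝ}
    (hw : (R + Bᵀ * X * B) *ᵥ w = 0) : R *ᵥ w = 0 := by
  have hmono : ∀ (x : Fin n → ℝ) (c : ℝ),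
      ((A - B * K) *ᵥ x + c • (B *ᵥ w)) ⬝ᵥ (X *ᵥ ((A - B * K) *ᵥ x + c • (B *ᵥ w))) ≤
        x ⬝ᵥ (X *ᵥ x) := by
    intro x c
    have h := quadratic_cost_eq_complete_square hR hX hK heq x (c • w)
    have hnn := hPi.dotProduct_mulVec_nonneg (Sum.elim x (c • w - K *ᵥ x))
    have hnext : A *ᵥ x + B *ᵥ (c • w - K *ᵥ x) = (A - B * K) *ᵥ x + c • (B *ᵥ w) := by
      rw [Matrix.mulVec_sub, Matrix.sub_mulVec, Matrix.mulVec_mulVec, Matrix.mulVec_smul]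
      abel
    rw [hnext, Matrix.mulVec_smul _ c w, hw, smul_zero, dotProduct_zero, add_zero] at h
    rw [star_trivial] at hnn
    linarith
  have hBw := apply_zero_le_of_forall_apply_le (fun x => x ⬝ᵥ (X *ᵥ x)) _ _ hmono
  have hsum : w ⬝ᵥ (R *ᵥ w) + (B *ᵥ w) ⬝ᵥ (X *ᵥ (B *ᵥ w)) = 0 := by
    rw [mulVec_dotProduct_eq, Matrix.mulVec_mulVec, Matrix.mulVec_mulVec, ← dotProduct_add,
      ← Matrix.add_mulVec, hw, dotProduct_zero]
  simp only [zero_dotProduct] at hBw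
  exact (hPi.mulVec_eq_zero_of_fromBlocks (by linarith)).2

/-- For every symmetric solution `X` of CGDARE(Σ), the closed-loop
matrix `A_X = A − B R_X† S_Xᵀ` satisfies `A_X = A₀ − B (R + Bᵀ X B)† Bᵀ X A₀`. -/
theorem stmt4 {n m : ℕ} (hn : 0 < n) (hm : 0 < m)
    (A : Matrix (Fin n) (Fin n) ℝ) (B : Matrix (Fin n) (Fin m) ℝ)
    (Q : Matrix (Fin n) (Fin n) ℝ) (S : Matrix (Fin n) (Fin m) ℝ)
    (R : Matrix (Fin m) (Fin m) ℝ)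
    (hQ : Qᵀ = Q) (hR : Rᵀ = R)
    (hPi : (fromBlocks Q S Sᵀ R).PosSemidef)
    (Rd : Matrix (Fin m) (Fin m) ℝ) (hRd : IsMP R Rd)
    (A0 : Matrix (Fin n) (Fin n) ℝ) (hA0 : A0 = A - B * Rd * Sᵀ)
    (X : Matrix (Fin n) (Fin n) ℝ) (hX : Xᵀ = X)
    (RXd : Matrix (Fin m) (Fin m) ℝ) (hRXd : IsMP (R + Bᵀ * X * B) RXd)
    (heq : X = Aᵀ * X * A - (Aᵀ * X * B + S) * RXd * (Aᵀ * X * B + S)ᵀ + Q)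
    (hker : LinearMap.ker (R + Bᵀ * X * B).mulVecLin ≤
      LinearMap.ker (Aᵀ * X * B + S).mulVecLin) :
    A - B * RXd * (Aᵀ * X * B + S)ᵀ = A0 - B * RXd * (Bᵀ * X * A0) := by
  have hRX : (R + Bᵀ * X * B)ᵀ = R + Bᵀ * X * B := by
    simp [Matrix.transpose_mul, hR, hX, Matrix.mul_assoc]
  have hK : (R + Bᵀ * X * B) * (RXd * (Aᵀ * X * B + S)ᵀ) = (Aᵀ * X * B + S)ᵀ := by
    rw [← Matrix.mul_assoc]
    exact hRXd.mul_mul_transpose_eq_of_ker_le hRX fun v hv => hker hv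
  have hRRX : R * RXd * (R + Bᵀ * X * B) = R :=
    hRXd.mul_mul_eq_of_ker_le fun v hv =>
      mulVec_eq_zero_of_riccati hPi hR hX hK (by rwa [← Matrix.mul_assoc]) hv
  have hproj : RXd * (R + Bᵀ * X * B) * R = R := by
    have h := congrArg Matrix.transpose hRRX
    rwa [Matrix.mul_assoc, Matrix.transpose_mul, hRXd.2.2.2, hR] at h
  have hRdR : Rd = R * (Rdᵀ * Rd) := by
    conv_lhs => rw [← hRd.2.1, ← hRd.2.2.2, Matrix.transpose_mul, hR, Matrix.mul_assoc]
  have hprojd : RXd * (R + Bᵀ * X * B) * Rd = Rd := by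
    rw [hRdR, ← Matrix.mul_assoc, hproj]
  have hRS : R * Rd * Sᵀ = Sᵀ :=
    hRd.mul_mul_transpose_eq_of_ker_le hR fun v hv =>
      (hPi.mulVec_eq_zero_of_fromBlocks (by rw [hv, dotProduct_zero])).1
  have hmain : RXd * Sᵀ + RXd * (Bᵀ * X * B) * (Rd * Sᵀ) = Rd * Sᵀ := by
    calc RXd * Sᵀ + RXd * (Bᵀ * X * B) * (Rd * Sᵀ)
        = RXd * (R * Rd * Sᵀ) + RXd * (Bᵀ * X * B) * (Rd * Sᵀ) := by rw [hRS]
      _ = RXd * (R + Bᵀ * X * B) * Rd * Sᵀ := by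
        simp only [Matrix.mul_add, Matrix.add_mul, Matrix.mul_assoc]
      _ = Rd * Sᵀ := by rw [hprojd]
  have hB : B * Rd * Sᵀ = B * (RXd * Sᵀ + RXd * (Bᵀ * X * B) * (Rd * Sᵀ)) := by
    rw [hmain, Matrix.mul_assoc]
  rw [Matrix.mul_add, ← sub_eq_iff_eq_add] at hB
  rw [hA0]
  simp only [Matrix.mul_add, Matrix.mul_sub, Matrix.transpose_add, Matrix.transpose_mul,
    Matrix.transpose_transpose, hX, Matrix.mul_assoc] at hB ⊢
  rw [← hB]
  abel
end

section
/- The reduced Popov matrix Π₁ = [[Q₁, S₁], [S₁ᵀ, R₁]], where Q₁ = Ãᵀ Q_U Ã, S₁ = Ãᵀ Q_U B_U and R₁ = R + B_Uᵀ Q_U B_U, is positive semidefinite. -/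
open Matrix

/-- The Moore–Penrose pseudoinverse of a symmetric matrix is symmetric. -/
theorem IsMP.transpose_eq {p : ℕ} {M Md : Matrix (Fin p) (Fin p) ℝ} (h : IsMP M Md)
    (hM : Mᵀ = M) : Mdᵀ = Md := by
  obtain ⟨h1, h2, h3, h4⟩ := h
  rw [transpose_mul, hM] at h3 h4
  have h1' : M * Mdᵀ * M = M := by
    have := congrArg transpose h1
    simpa only [transpose_mul, hM, Matrix.mul_assoc] using this
  have h2' : Mdᵀ * M * Mdᵀ = Mdᵀ := by
    have := congrArg transpose h2
    simpa only [transpose_mul, hM, Matrix.mul_assoc] using this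
  have hcomm : Md * M = M * Md := by
    calc Md * M = M * Mdᵀ := h4.symm
      _ = (M * Md * M) * Mdᵀ := by rw [h1]
      _ = (M * Md) * (M * Mdᵀ) := by simp only [Matrix.mul_assoc]
      _ = (Mdᵀ * M) * (Md * M) := by rw [h3, h4]
      _ = Mdᵀ * (M * Md * M) := by simp only [Matrix.mul_assoc]
      _ = M * Md := by rw [h1, h3]
  calc Mdᵀ = Mdᵀ * M * Mdᵀ := h2'.symm
    _ = Md * M * Mdᵀ := by rw [h3, hcomm]
    _ = Md * (M * Mdᵀ) := Matrix.mul_assoc _ _ _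
    _ = Md * (M * Md) := by rw [h4, hcomm]
    _ = Md := by rw [← Matrix.mul_assoc, h2]

/-- The generalized Schur complement of a positive semidefinite block matrix is
positive semidefinite. -/
theorem IsMP.posSemidef_schur {n m : ℕ} {Q : Matrix (Fin n) (Fin n) ℝ}
    {S : Matrix (Fin n) (Fin m) ℝ} {R Rd : Matrix (Fin m) (Fin m) ℝ} (h : IsMP R Rd)
    (hR : Rᵀ = R) (hPi : (fromBlocks Q S Sᵀ R).PosSemidef) :
    (Q - S * Rd * Sᵀ).PosSemidef := by
  have hRd := h.transpose_eq hR
  have := hPi.conjTranspose_mul_mul_same (fromRows 1 (-(Rd * Sᵀ)))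
  convert this using 1
  have h2 : S * (Rd * (R * (Rd * Sᵀ))) = S * (Rd * Sᵀ) := by
    rw [← Matrix.mul_assoc R, ← Matrix.mul_assoc Rd, ← Matrix.mul_assoc Rd, h.2.1]
  rw [conjTranspose_eq_transpose_of_trivial, transpose_fromRows, fromCols_mul_fromBlocks,
    fromCols_mul_fromRows]
  simp [hRd, Matrix.mul_assoc, Matrix.add_mul, h2, sub_eq_add_neg]

/-- The reduced Popov matrix `Π₁ = [[Q₁, S₁], [S₁ᵀ, R₁]]`, with
`Q₁ = Ãᵀ Q_U Ã`, `S₁ = Ãᵀ Q_U B_U`, `R₁ = R + B_Uᵀ Q_U B_U`, is positive semidefinite. -/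
theorem stmt10 {n m ν : ℕ} (hn : 0 < n) (hm : 0 < m)
    (A : Matrix (Fin n) (Fin n) ℝ) (B : Matrix (Fin n) (Fin m) ℝ)
    (Q : Matrix (Fin n) (Fin n) ℝ) (S : Matrix (Fin n) (Fin m) ℝ)
    (R : Matrix (Fin m) (Fin m) ℝ)
    (hQ : Qᵀ = Q) (hR : Rᵀ = R)
    (hPi : (fromBlocks Q S Sᵀ R).PosSemidef)
    (Rd : Matrix (Fin m) (Fin m) ℝ) (hRd : IsMP R Rd)
    (A0 Q0 : Matrix (Fin n) (Fin n) ℝ)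
    (hA0 : A0 = A - B * Rd * Sᵀ) (hQ0 : Q0 = Q - S * Rd * Sᵀ)
    (hnu : ν = Module.finrank ℝ (LinearMap.ker A0.mulVecLin))
    (U : Matrix (Fin n) (Fin (n - ν) ⊕ Fin ν) ℝ)
    (hUl : Uᵀ * U = 1) (hUr : U * Uᵀ = 1)
    (hUspan : LinearMap.range (U.submatrix id Sum.inr).mulVecLin =
      LinearMap.ker A0.mulVecLin)
    (Atil : Matrix (Fin (n - ν) ⊕ Fin ν) (Fin (n - ν)) ℝ)
    (hAtil : Atil = Uᵀ * A0 * U.submatrix id Sum.inl)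
    (BU : Matrix (Fin (n - ν) ⊕ Fin ν) (Fin m) ℝ) (hBU : BU = Uᵀ * B)
    (QU : Matrix (Fin (n - ν) ⊕ Fin ν) (Fin (n - ν) ⊕ Fin ν) ℝ) (hQU : QU = Uᵀ * Q0 * U)
    (Q1 : Matrix (Fin (n - ν)) (Fin (n - ν)) ℝ) (hQ1 : Q1 = Atilᵀ * QU * Atil)
    (S1 : Matrix (Fin (n - ν)) (Fin m) ℝ) (hS1 : S1 = Atilᵀ * QU * BU)
    (R1 : Matrix (Fin m) (Fin m) ℝ) (hR1 : R1 = R + BUᵀ * QU * BU)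
    : (fromBlocks Q1 S1 S1ᵀ R1).PosSemidef := by
  have hQ0psd : Q0.PosSemidef := hQ0 ▸ hRd.posSemidef_schur hR hPi
  have hQUpsd : QU.PosSemidef := by
    have := hQ0psd.conjTranspose_mul_mul_same U
    rwa [conjTranspose_eq_transpose_of_trivial, ← hQU] at this
  have hQUt : QUᵀ = QU := hQUpsd.isHermitian
  have hRpsd : R.PosSemidef := hPi.submatrix Sum.inr
  have h1 := hRpsd.conjTranspose_mul_mul_same
    (fromCols (0 : Matrix (Fin m) (Fin (n - ν)) ℝ) (1 : Matrix (Fin m) (Fin m) ℝ))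
  have h2 := hQUpsd.conjTranspose_mul_mul_same (fromCols Atil BU)
  convert h1.add h2 using 1
  simp only [conjTranspose_eq_transpose_of_trivial, transpose_fromCols, fromRows_mul _ _ R,
    fromRows_mul _ _ QU]
  rw [fromRows_mul_fromCols, fromRows_mul_fromCols, fromBlocks_add]
  simp [hQ1, hS1, hR1, hQUt, Matrix.mul_assoc]
end

section
/- Let X be a symmetric solution of CGDARE(Σ), write X_U = Uᵀ X U and let X₁₁ be its leading (n−ν)×(n−ν) block. Then Δ₁ = X₁₁ − Q₁₁ is a symmetric solution of the reduced equation CGDARE(Σ₁): Δ₁ = A₁ᵀ Δ₁ A₁ − (A₁ᵀ Δ₁ B₁ + S₁)(R₁ + B₁ᵀ Δ₁ B₁)†(B₁ᵀ Δ₁ A₁ + S₁ᵀ) + Q₁ and ker(R₁ + B₁ᵀ Δ₁ B₁) ⊆ ker(S₁ + A₁ᵀ Δ₁ B₁). -/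
open Matrix

/-- If `ker M ⊆ ker N`, then `N` factors through `M` via the pseudoinverse of `M`. -/
theorem IsMP.mul_mul_of_ker_le {p q r : ℕ} {M : Matrix (Fin p) (Fin q) ℝ}
    {Md : Matrix (Fin q) (Fin p) ℝ} (h : IsMP M Md) {N : Matrix (Fin r) (Fin q) ℝ}
    (hker : LinearMap.ker M.mulVecLin ≤ LinearMap.ker N.mulVecLin) : N * Md * M = N := by
  apply Matrix.ext_of_mulVec_single
  intro i
  have hM : M *ᵥ ((1 - Md * M) *ᵥ Pi.single i 1) = 0 := by
    rw [mulVec_mulVec, Matrix.mul_sub, ← Matrix.mul_assoc, h.1, Matrix.mul_one, sub_self,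
      zero_mulVec]
  have hN : N *ᵥ ((1 - Md * M) *ᵥ Pi.single i 1) = 0 := hker hM
  rw [mulVec_mulVec, Matrix.mul_sub, Matrix.mul_one, sub_mulVec, sub_eq_zero] at hN
  rw [Matrix.mul_assoc, ← hN]

theorem Matrix.PosSemidef.ker_le_ker_of_fromBlocks {m n : ℕ} {Q : Matrix (Fin n) (Fin n) ℝ}
    {S : Matrix (Fin n) (Fin m) ℝ} {R : Matrix (Fin m) (Fin m) ℝ}
    (h : (fromBlocks Q S Sᵀ R).PosSemidef) :
    LinearMap.ker R.mulVecLin ≤ LinearMap.ker S.mulVecLin := by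
  intro x hx
  have hRx : R *ᵥ x = 0 := hx
  have hmul : fromBlocks Q S Sᵀ R *ᵥ Sum.elim 0 x = Sum.elim (S *ᵥ x) 0 := by
    simp [fromBlocks_mulVec, hRx]
  have hzero := (h.dotProduct_mulVec_zero_iff (Sum.elim 0 x)).1 (by
    rw [hmul]; simp [dotProduct])
  rw [hmul] at hzero
  show S *ᵥ x = 0
  ext i
  exact congrFun hzero (Sum.inl i)

/-- A generalized inverse sandwiched between matrices factoring through `M` does not depend on
the choice of generalized inverse. -/
theorem mul_mul_transpose_eq_of_factor {p q : ℕ} {M Md : Matrix (Fin q) (Fin q) ℝ}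
    (hM : Mᵀ = M) (h : M * Md * M = M) {N L : Matrix (Fin p) (Fin q) ℝ} (hN : N = L * M) :
    N * Md * Nᵀ = L * M * Lᵀ := by
  calc N * Md * Nᵀ = L * (M * Md * M) * Lᵀ := by
        rw [hN, transpose_mul, hM]; simp only [Matrix.mul_assoc]
    _ = _ := by rw [h]

/-- The feedback `K` with `S = Kᵀ R` removes the cross term from the Riccati equation. -/
theorem riccati_of_feedback {n m : ℕ} {A Q X : Matrix (Fin n) (Fin n) ℝ}
    {B S P : Matrix (Fin n) (Fin m) ℝ} {R : Matrix (Fin m) (Fin m) ℝ}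
    {K : Matrix (Fin m) (Fin n) ℝ} (hX : Xᵀ = X) (hR : Rᵀ = R) (hS : S = Kᵀ * R)
    (hP : Aᵀ * X * B + S = P * (R + Bᵀ * X * B))
    (heq : X = Aᵀ * X * A - P * (R + Bᵀ * X * B) * Pᵀ + Q) :
    (A - B * K)ᵀ * X * B = (P - Kᵀ) * (R + Bᵀ * X * B) ∧
    X = (A - B * K)ᵀ * X * (A - B * K) - (P - Kᵀ) * (R + Bᵀ * X * B) * (P - Kᵀ)ᵀ
      + (Q - Kᵀ * R * K) := by
  have hP' : Bᵀ * X * A + R * K = (R + Bᵀ * X * B) * Pᵀ := by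
    have := congrArg transpose hP
    simpa [hS, hX, hR, Matrix.mul_assoc] using this
  constructor
  · rw [Matrix.sub_mul, ← hP, hS]
    simp only [transpose_sub, transpose_mul, Matrix.sub_mul, Matrix.mul_add, Matrix.mul_assoc]
    abel
  · have h1 : (P - Kᵀ) * (R + Bᵀ * X * B) * (P - Kᵀ)ᵀ = P * (R + Bᵀ * X * B) * Pᵀ
        - P * (R + Bᵀ * X * B) * K - Kᵀ * ((R + Bᵀ * X * B) * Pᵀ)
        + Kᵀ * (R + Bᵀ * X * B) * K := by
      simp only [transpose_sub, transpose_transpose, Matrix.sub_mul, Matrix.mul_sub,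
        Matrix.mul_assoc]
      abel
    rw [← hP] at heq
    rw [h1, ← hP', ← hP, hS]
    rw [hS] at heq
    nth_rewrite 1 [heq]
    simp only [transpose_sub, transpose_mul, Matrix.sub_mul, Matrix.mul_sub, Matrix.add_mul,
      Matrix.mul_add, Matrix.mul_assoc]
    abel

/-- If `X` is a symmetric solution of CGDARE(Σ) and `X₁₁` is the
leading block of `Uᵀ X U`, then `Δ₁ = X₁₁ − Q₁₁` is a symmetric solution of the
reduced equation CGDARE(Σ₁). -/
theorem stmt11 {n m ν : ℕ} (hn : 0 < n) (hm : 0 < m)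
    (A : Matrix (Fin n) (Fin n) ℝ) (B : Matrix (Fin n) (Fin m) ℝ)
    (Q : Matrix (Fin n) (Fin n) ℝ) (S : Matrix (Fin n) (Fin m) ℝ)
    (R : Matrix (Fin m) (Fin m) ℝ)
    (hQ : Qᵀ = Q) (hR : Rᵀ = R)
    (hPi : (fromBlocks Q S Sᵀ R).PosSemidef)
    (Rd : Matrix (Fin m) (Fin m) ℝ) (hRd : IsMP R Rd)
    (A0 Q0 : Matrix (Fin n) (Fin n) ℝ)
    (hA0 : A0 = A - B * Rd * Sᵀ) (hQ0 : Q0 = Q - S * Rd * Sᵀ)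
    (hnu : ν = Module.finrank ℝ (LinearMap.ker A0.mulVecLin))
    (U : Matrix (Fin n) (Fin (n - ν) ⊕ Fin ν) ℝ)
    (hUl : Uᵀ * U = 1) (hUr : U * Uᵀ = 1)
    (hUspan : LinearMap.range (U.submatrix id Sum.inr).mulVecLin =
      LinearMap.ker A0.mulVecLin)
    (Atil : Matrix (Fin (n - ν) ⊕ Fin ν) (Fin (n - ν)) ℝ)
    (hAtil : Atil = Uᵀ * A0 * U.submatrix id Sum.inl)
    (BU : Matrix (Fin (n - ν) ⊕ Fin ν) (Fin m) ℝ) (hBU : BU = Uᵀ * B)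
    (QU : Matrix (Fin (n - ν) ⊕ Fin ν) (Fin (n - ν) ⊕ Fin ν) ℝ) (hQU : QU = Uᵀ * Q0 * U)
    (Q1 : Matrix (Fin (n - ν)) (Fin (n - ν)) ℝ) (hQ1 : Q1 = Atilᵀ * QU * Atil)
    (S1 : Matrix (Fin (n - ν)) (Fin m) ℝ) (hS1 : S1 = Atilᵀ * QU * BU)
    (R1 : Matrix (Fin m) (Fin m) ℝ) (hR1 : R1 = R + BUᵀ * QU * BU)
    (A1 : Matrix (Fin (n - ν)) (Fin (n - ν)) ℝ) (hA1 : A1 = Atil.submatrix Sum.inl id)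
    (B1 : Matrix (Fin (n - ν)) (Fin m) ℝ) (hB1 : B1 = BU.submatrix Sum.inl id)
    (X : Matrix (Fin n) (Fin n) ℝ) (hX : Xᵀ = X)
    (RXd : Matrix (Fin m) (Fin m) ℝ) (hRXd : IsMP (R + Bᵀ * X * B) RXd)
    (heq : X = Aᵀ * X * A - (Aᵀ * X * B + S) * RXd * (Aᵀ * X * B + S)ᵀ + Q)
    (hker : LinearMap.ker (R + Bᵀ * X * B).mulVecLin ≤
      LinearMap.ker (Aᵀ * X * B + S).mulVecLin)
    (D1 : Matrix (Fin (n - ν)) (Fin (n - ν)) ℝ)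
    (hD1 : D1 = (Uᵀ * X * U).toBlocks₁₁ - QU.toBlocks₁₁)
    (RD1d : Matrix (Fin m) (Fin m) ℝ) (hRD1d : IsMP (R1 + B1ᵀ * D1 * B1) RD1d) :
    D1ᵀ = D1 ∧
    D1 = A1ᵀ * D1 * A1 - (A1ᵀ * D1 * B1 + S1) * RD1d * (B1ᵀ * D1 * A1 + S1ᵀ) + Q1 ∧
    LinearMap.ker (R1 + B1ᵀ * D1 * B1).mulVecLin ≤
      LinearMap.ker (S1 + A1ᵀ * D1 * B1).mulVecLin := by
  have hS := hRd.mul_mul_of_ker_le hPi.ker_le_ker_of_fromBlocks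
  set RX := R + Bᵀ * X * B with hRX
  have hRXt : RXᵀ = RX := by simp [hRX, hR, hX, Matrix.mul_assoc]
  have hP := hRXd.mul_mul_of_ker_le hker
  set P := (Aᵀ * X * B + S) * RXd
  set K := Rd * Sᵀ with hK
  have hSK : S = Kᵀ * R := by
    have h1 : R * Rd * Sᵀ = Sᵀ := by
      have h2 : S * (R * Rd) = S := by
        have h3 : R * (R * Rd) = R := by
          have := congrArg transpose hRd.1
          rwa [transpose_mul, hRd.2.2.1, hR] at this
        conv_lhs => rw [← hS]
        rw [Matrix.mul_assoc (S * Rd), h3, hS]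
      have := congrArg transpose h2
      rwa [transpose_mul, hRd.2.2.1] at this
    have := congrArg transpose h1
    rw [Matrix.mul_assoc, ← hK, transpose_mul, transpose_transpose, hR] at this
    exact this.symm
  have hPRP := mul_mul_transpose_eq_of_factor hRXt hRXd.1 hP.symm
  rw [hPRP] at heq
  obtain ⟨hL, hXeq⟩ := riccati_of_feedback hX hR hSK hP.symm heq
  rw [← hRX] at hL hXeq
  rw [Matrix.mul_assoc, ← hK] at hA0
  have hQ0' : Q0 = Q - Kᵀ * R * K := by rw [← hSK, hQ0, hK, Matrix.mul_assoc]
  rw [← hA0] at hL hXeq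
  rw [← hQ0'] at hXeq
  set L := P - Kᵀ
  set J : Matrix (Fin (n - ν) ⊕ Fin ν) (Fin (n - ν)) ℝ :=
    (1 : Matrix (Fin (n - ν) ⊕ Fin ν) (Fin (n - ν) ⊕ Fin ν) ℝ).submatrix id Sum.inl with hJ
  have hJt {k : ℕ} (M : Matrix (Fin (n - ν) ⊕ Fin ν) (Fin k) ℝ) :
      M.submatrix Sum.inl id = Jᵀ * M := by
    ext i j
    simp [hJ, Matrix.mul_apply, Matrix.one_apply]
  have hU1 : U.submatrix id Sum.inl = U * J := by
    ext i j
    simp [hJ, Matrix.mul_apply, Matrix.one_apply]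
  have hblock (M : Matrix (Fin (n - ν) ⊕ Fin ν) (Fin (n - ν) ⊕ Fin ν) ℝ) :
      M.toBlocks₁₁ = Jᵀ * M * J := by
    ext i j
    simp [hJ, Matrix.mul_apply, Matrix.one_apply, toBlocks₁₁]
  have hJJ : Jᵀ * J = 1 := by
    ext i j
    simp [hJ, Matrix.mul_apply, Matrix.one_apply]
  have hA0U : A0 * U = A0 * U * J * Jᵀ := by
    have hz : A0 * U.submatrix id Sum.inr = 0 := by
      apply Matrix.ext_of_mulVec_single
      intro i
      have hmem : (U.submatrix id Sum.inr) *ᵥ Pi.single i 1 ∈ LinearMap.ker A0.mulVecLin :=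
        hUspan ▸ ⟨Pi.single i 1, rfl⟩
      rw [zero_mulVec, ← mulVec_mulVec]
      exact hmem
    ext i j
    rcases j with j | j
    · simp [hJ, Matrix.mul_apply, Matrix.one_apply]
    · have : (A0 * U) i (Sum.inr j) = 0 := congrFun (congrFun hz i) j
      rw [this]
      simp [hJ, Matrix.mul_apply, Matrix.one_apply]
  set T := A0 * U * J with hT
  have hAt : Atil = Uᵀ * T := by rw [hAtil, hU1, hT]; simp only [Matrix.mul_assoc]
  have hLRL := mul_mul_transpose_eq_of_factor hRXt hRXd.1 hL
  set F := Tᵀ * X * T - Tᵀ * X * B * RXd * (Bᵀ * X * T) with hF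
  have hXU : Uᵀ * X * U = QU + J * F * Jᵀ := by
    have h1 : Uᵀ * X * U = (A0 * U)ᵀ * X * (A0 * U)
        - (A0 * U)ᵀ * X * B * RXd * (Bᵀ * X * (A0 * U)) + QU := by
      rw [hQU]
      nth_rewrite 1 [hXeq]
      rw [← hLRL]
      simp only [transpose_mul, transpose_transpose, hX, Matrix.sub_mul, Matrix.mul_sub,
        Matrix.add_mul, Matrix.mul_add, Matrix.mul_assoc]
    rw [h1, hA0U, hF]
    simp only [transpose_mul, transpose_transpose, Matrix.sub_mul, Matrix.mul_sub,
      Matrix.mul_assoc]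
    abel
  have hDF : D1 = F := by
    rw [hD1, hblock, hblock, hXU]
    calc _ = (Jᵀ * J) * F * (Jᵀ * J) := by
          simp only [Matrix.mul_add, Matrix.add_mul, Matrix.mul_assoc]; abel
      _ = F := by rw [hJJ, Matrix.one_mul, Matrix.mul_one]
  rw [← hDF] at hXU
  have hXU' : X = U * (QU + J * D1 * Jᵀ) * Uᵀ := by
    rw [← hXU]
    calc X = (U * Uᵀ) * X * (U * Uᵀ) := by rw [hUr, Matrix.one_mul, Matrix.mul_one]
      _ = _ := by simp only [Matrix.mul_assoc]
  have hD1t : D1ᵀ = D1 := by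
    have hQUt : QUᵀ = QU := by
      rw [hQU, hQ0']
      simp [hQ, hR, Matrix.mul_assoc]
    rw [hD1, transpose_sub, hblock, hblock]
    simp [hQUt, hX, Matrix.mul_assoc]
  have hTT : Tᵀ * X * T = Q1 + A1ᵀ * D1 * A1 := by
    rw [hXU', hQ1, hA1, hJt, hAt]
    simp only [transpose_mul, transpose_transpose, Matrix.mul_add, Matrix.add_mul,
      Matrix.mul_assoc]
  have hTB : Tᵀ * X * B = A1ᵀ * D1 * B1 + S1 := by
    rw [hXU', hS1, hA1, hB1, hJt, hJt, hAt, hBU]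
    simp only [transpose_mul, transpose_transpose, Matrix.mul_add, Matrix.add_mul,
      Matrix.mul_assoc]
    abel
  have hBB : RX = R1 + B1ᵀ * D1 * B1 := by
    rw [hRX, hXU', hR1, hB1, hJt, hBU]
    simp only [transpose_mul, transpose_transpose, Matrix.mul_add, Matrix.add_mul,
      Matrix.mul_assoc]
    abel
  have hTL : Tᵀ * X * B = Jᵀ * Uᵀ * L * RX := by
    rw [Matrix.mul_assoc _ L, ← hL, hT]
    simp only [transpose_mul, Matrix.mul_assoc]
  rw [← hBB] at hRD1d
  have hBT : (Tᵀ * X * B)ᵀ = Bᵀ * X * T := by simp [hX, Matrix.mul_assoc]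
  have hS1t : B1ᵀ * D1 * A1 + S1ᵀ = Bᵀ * X * T := by
    rw [← hBT, hTB]; simp [hD1t, Matrix.mul_assoc]
  refine ⟨hD1t, ?_, ?_⟩
  · rw [← hTB, hS1t, ← hBT, mul_mul_transpose_eq_of_factor hRXt hRD1d.1 hTL,
      ← mul_mul_transpose_eq_of_factor hRXt hRXd.1 hTL, hBT, sub_add_eq_add_sub,
      add_comm _ Q1, ← hTT, ← hF, hDF]
  · rw [← hBB, add_comm S1, ← hTB, hTL]
    intro x hx
    have hx' : RX *ᵥ x = 0 := hx
    show (Jᵀ * Uᵀ * L * RX) *ᵥ x = 0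
    rw [← mulVec_mulVec, hx', mulVec_zero]
end

section
/- Let X be a symmetric solution of CGDARE(Σ) and write X_V = Vᵀ X V = [[X₁₁, X₁₂], [X₁₂ᵀ, X₂₂]] with X₁₁ ∈ ℝ^{(n−η)×(n−η)}. Then X₁₂ = Q₁₂ and X₂₂ = Q₂₂. -/
open Matrix

/-- In a positive semidefinite block matrix, the kernel of the lower-right block is contained in
the kernel of the upper-right block. -/
lemma mulVec_eq_zero_of_posSemidef_fromBlocks {n m : ℕ} {Q : Matrix (Fin n) (Fin n) ℝ}
    {S : Matrix (Fin n) (Fin m) ℝ} {R : Matrix (Fin m) (Fin m) ℝ}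
    (hPi : (fromBlocks Q S Sᵀ R).PosSemidef) {k : Fin m → ℝ} (hk : R *ᵥ k = 0) :
    S *ᵥ k = 0 := by
  have h : fromBlocks Q S Sᵀ R *ᵥ Sum.elim 0 k = Sum.elim (S *ᵥ k) 0 := by
    simp [fromBlocks_mulVec, hk]
  have h0 : fromBlocks Q S Sᵀ R *ᵥ Sum.elim 0 k = 0 := by
    rw [← hPi.dotProduct_mulVec_zero_iff, h]
    simp [dotProduct]
  ext i
  simpa using congrFun (h.symm.trans h0) (Sum.inl i)

/-- If `ker M ⊆ ker N`, then `N` is invariant under right multiplication by `G * M` for every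
inner inverse `G` of `M`. -/
lemma mul_mul_eq_of_ker_le {n m : ℕ} {N : Matrix (Fin n) (Fin m) ℝ}
    {M G : Matrix (Fin m) (Fin m) ℝ} (hG : M * G * M = M)
    (h : ∀ k, M *ᵥ k = 0 → N *ᵥ k = 0) : N * G * M = N := by
  refine ext_of_mulVec_single fun i => ?_
  have := h ((G * M) *ᵥ Pi.single i 1 - Pi.single i 1) (by
    rw [mulVec_sub, mulVec_mulVec, ← Matrix.mul_assoc, hG, sub_self])
  rwa [mulVec_sub, mulVec_mulVec, ← Matrix.mul_assoc, sub_eq_zero] at this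

/-- A solution `X` of the generalized Riccati equation agrees with `Q - S R† Sᵀ` on every `w`
that `A - B R† Sᵀ` maps into `B (ker R)`. -/
lemma riccati_mulVec_eq {n m : ℕ} {A Q X : Matrix (Fin n) (Fin n) ℝ}
    {B S : Matrix (Fin n) (Fin m) ℝ} {R Rd RXd : Matrix (Fin m) (Fin m) ℝ}
    (hX : Xᵀ = X) (hS : R * Rd * Sᵀ = Sᵀ)
    (hSX : (Aᵀ * X * B + S) * RXd * (R + Bᵀ * X * B) = Aᵀ * X * B + S)
    (heq : X = Aᵀ * X * A - (Aᵀ * X * B + S) * RXd * (Aᵀ * X * B + S)ᵀ + Q)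
    {w : Fin n → ℝ} {k : Fin m → ℝ} (hRk : R *ᵥ k = 0) (hSk : S *ᵥ k = 0)
    (hw : (A - B * Rd * Sᵀ) *ᵥ w = B *ᵥ k) :
    X *ᵥ w = (Q - S * Rd * Sᵀ) *ᵥ w := by
  set v := k + (Rd * Sᵀ) *ᵥ w with hv
  have hAw : A *ᵥ w = B *ᵥ v := by
    rw [hv, mulVec_add, ← hw, mulVec_mulVec, sub_mulVec, Matrix.mul_assoc, sub_add_cancel]
  have hRv : R *ᵥ v = Sᵀ *ᵥ w := by
    rw [hv, mulVec_add, hRk, mulVec_mulVec, ← Matrix.mul_assoc, hS, zero_add]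
  have hSv : S *ᵥ v = (S * Rd * Sᵀ) *ᵥ w := by
    rw [hv, mulVec_add, hSk, mulVec_mulVec, ← Matrix.mul_assoc, zero_add]
  have hSXw : (Aᵀ * X * B + S)ᵀ *ᵥ w = (R + Bᵀ * X * B) *ᵥ v := by
    simp only [transpose_add, transpose_mul, transpose_transpose, hX, add_mulVec, hRv,
      ← mulVec_mulVec, hAw]
    exact add_comm _ _
  have hXw : X *ᵥ w = (Aᵀ * X) *ᵥ (A *ᵥ w)
      - ((Aᵀ * X * B + S) * RXd) *ᵥ ((Aᵀ * X * B + S)ᵀ *ᵥ w) + Q *ᵥ w := by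
    conv_lhs => rw [heq]
    simp only [add_mulVec, sub_mulVec, mulVec_mulVec]
  rw [hXw, hSXw, mulVec_mulVec _ _ (R + _), hSX, hAw, add_mulVec, hSv, sub_mulVec,
    mulVec_mulVec]
  abel

/-- For a symmetric solution `X` of CGDARE(Σ), writing
`X_V = Vᵀ X V` in blocks, the off-diagonal and lower-right blocks of `X_V`
coincide with those of `Q_V = Vᵀ Q₀ V`. -/
theorem stmt15 {n m η : ℕ} (hn : 0 < n) (hm : 0 < m)
    (A : Matrix (Fin n) (Fin n) ℝ) (B : Matrix (Fin n) (Fin m) ℝ)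
    (Q : Matrix (Fin n) (Fin n) ℝ) (S : Matrix (Fin n) (Fin m) ℝ)
    (R : Matrix (Fin m) (Fin m) ℝ)
    (hQ : Qᵀ = Q) (hR : Rᵀ = R)
    (hPi : (fromBlocks Q S Sᵀ R).PosSemidef)
    (Rd : Matrix (Fin m) (Fin m) ℝ) (hRd : IsMP R Rd)
    (A0 Q0 : Matrix (Fin n) (Fin n) ℝ)
    (hA0 : A0 = A - B * Rd * Sᵀ) (hQ0 : Q0 = Q - S * Rd * Sᵀ)
    (hA0inv : IsUnit A0)
    (heta : η = Module.finrank ℝ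
      (Submodule.map (A0⁻¹ * B).mulVecLin (LinearMap.ker R.mulVecLin)))
    (V : Matrix (Fin n) (Fin (n - η) ⊕ Fin η) ℝ)
    (hVl : Vᵀ * V = 1) (hVr : V * Vᵀ = 1)
    (hVspan : LinearMap.range (V.submatrix id Sum.inr).mulVecLin =
      Submodule.map (A0⁻¹ * B).mulVecLin (LinearMap.ker R.mulVecLin))
    (X : Matrix (Fin n) (Fin n) ℝ) (hX : Xᵀ = X)
    (RXd : Matrix (Fin m) (Fin m) ℝ) (hRXd : IsMP (R + Bᵀ * X * B) RXd)
    (heq : X = Aᵀ * X * A - (Aᵀ * X * B + S) * RXd * (Aᵀ * X * B + S)ᵀ + Q)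
    (hker : LinearMap.ker (R + Bᵀ * X * B).mulVecLin ≤
      LinearMap.ker (Aᵀ * X * B + S).mulVecLin) :
    (Vᵀ * X * V).toBlocks₁₂ = (Vᵀ * Q0 * V).toBlocks₁₂ ∧
    (Vᵀ * X * V).toBlocks₂₂ = (Vᵀ * Q0 * V).toBlocks₂₂ := by
  have hSker : ∀ k, R *ᵥ k = 0 → S *ᵥ k = 0 :=
    fun k hk => mulVec_eq_zero_of_posSemidef_fromBlocks hPi hk
  have hS : R * Rd * Sᵀ = Sᵀ := by
    have hG : R * Rdᵀ * R = R := by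
      simpa [transpose_mul, hR, Matrix.mul_assoc] using congrArg transpose hRd.1
    simpa [transpose_mul, hR, Matrix.mul_assoc] using
      congrArg transpose (mul_mul_eq_of_ker_le hG hSker)
  have hSX := mul_mul_eq_of_ker_le hRXd.1 fun k hk => hker hk
  have hdet : IsUnit A0.det := (isUnit_iff_isUnit_det A0).1 hA0inv
  have hcol : ∀ j, X *ᵥ V.col (Sum.inr j) = Q0 *ᵥ V.col (Sum.inr j) := by
    intro j
    have hmem : V.col (Sum.inr j) ∈
        LinearMap.range (V.submatrix id Sum.inr).mulVecLin :=
      ⟨Pi.single j 1, by ext; simp⟩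
    rw [hVspan] at hmem
    obtain ⟨k, hk, hkw⟩ := hmem
    have hRk : R *ᵥ k = 0 := hk
    rw [hQ0]
    refine riccati_mulVec_eq hX hS hSX heq hRk (hSker k hRk) ?_
    rw [← hA0, ← hkw, mulVecLin_apply, mulVec_mulVec, mul_nonsing_inv_cancel_left _ _ hdet]
  have hentry : ∀ i j, (Vᵀ * X * V) i (Sum.inr j) = (Vᵀ * Q0 * V) i (Sum.inr j) := by
    intro i j
    simp only [Matrix.mul_assoc]
    exact congrArg (fun x => Vᵀ i ⬝ᵥ x) (hcol j)
  exact ⟨ext fun _ j => hentry _ j, ext fun _ j => hentry _ j⟩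
end

section
/- The reduced Popov matrix Π₁ = [[Q₁, S₁], [S₁ᵀ, R₁]], where Q₁ is the leading (n−η)×(n−η) block of A_Vᵀ Q_V A_V, S₁ is the top (n−η)×m block of A_Vᵀ Q_V B_V, and R₁ = R + Bᵀ Q₀ B, is positive semidefinite. -/
open Matrix

theorem IsMP.transpose_eq_s16 {m : ℕ} {R K : Matrix (Fin m) (Fin m) ℝ} (hR : Rᵀ = R)
    (h : IsMP R K) : Kᵀ = K := by
  obtain ⟨h1, h2, h3, h4⟩ := h
  have h1' : R * Kᵀ * R = R := by
    simpa [Matrix.transpose_mul, hR, Matrix.mul_assoc] using congrArg Matrix.transpose h1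
  rw [Matrix.transpose_mul, hR] at h3 h4
  have hc : R * K = K * R := by
    calc R * K = (R * Kᵀ * R) * K := by rw [h1']
      _ = K * (R * R * K) := by rw [h4]; simp only [Matrix.mul_assoc]
      _ = K * (R * (Kᵀ * R)) := by rw [h3, Matrix.mul_assoc]
      _ = K * R := by rw [← Matrix.mul_assoc R, h1']
  calc Kᵀ = (K * R * K)ᵀ := by rw [h2]
    _ = Kᵀ * R * Kᵀ := by simp [Matrix.transpose_mul, hR, Matrix.mul_assoc]
    _ = R * K * Kᵀ := by rw [h3]
    _ = K * (R * Kᵀ) := by rw [hc, Matrix.mul_assoc]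
    _ = K * (R * K) := by rw [h4, hc]
    _ = K := by rw [← Matrix.mul_assoc, h2]

theorem posSemidef_generalized_schur {n m : ℕ} {Q : Matrix (Fin n) (Fin n) ℝ}
    {S : Matrix (Fin n) (Fin m) ℝ} {R K : Matrix (Fin m) (Fin m) ℝ} (hR : Rᵀ = R)
    (hPi : (fromBlocks Q S Sᵀ R).PosSemidef) (hK : IsMP R K) :
    (Q - S * K * Sᵀ).PosSemidef := by
  have hKt := hK.transpose_eq_s16 hR
  have h := hPi.conjTranspose_mul_mul_same (fromRows 1 (-(K * Sᵀ)))
  convert h using 1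
  have e : S * (K * (R * (K * Sᵀ))) = S * (K * Sᵀ) := by
    rw [← Matrix.mul_assoc R, ← Matrix.mul_assoc K, ← Matrix.mul_assoc K R K, hK.2.1]
  rw [conjTranspose_eq_transpose_of_trivial, transpose_fromRows, fromCols_mul_fromBlocks,
    fromCols_mul_fromRows]
  simp [Matrix.transpose_mul, hKt, Matrix.mul_assoc, Matrix.add_mul, e]
  abel

/-- The reduced Popov matrix `Π₁ = [[Q₁, S₁], [S₁ᵀ, R₁]]`, where `Q₁`
is the leading block of `A_Vᵀ Q_V A_V`, `S₁` the top block of `A_Vᵀ Q_V B_V`, and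
`R₁ = R + Bᵀ Q₀ B`, is positive semidefinite. -/
theorem stmt16 {n m η : ℕ} (hn : 0 < n) (hm : 0 < m)
    (A : Matrix (Fin n) (Fin n) ℝ) (B : Matrix (Fin n) (Fin m) ℝ)
    (Q : Matrix (Fin n) (Fin n) ℝ) (S : Matrix (Fin n) (Fin m) ℝ)
    (R : Matrix (Fin m) (Fin m) ℝ)
    (hQ : Qᵀ = Q) (hR : Rᵀ = R)
    (hPi : (fromBlocks Q S Sᵀ R).PosSemidef)
    (Rd : Matrix (Fin m) (Fin m) ℝ) (hRd : IsMP R Rd)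
    (A0 Q0 : Matrix (Fin n) (Fin n) ℝ)
    (hA0 : A0 = A - B * Rd * Sᵀ) (hQ0 : Q0 = Q - S * Rd * Sᵀ)
    (hA0inv : IsUnit A0)
    (heta : η = Module.finrank ℝ
      (Submodule.map (A0⁻¹ * B).mulVecLin (LinearMap.ker R.mulVecLin)))
    (V : Matrix (Fin n) (Fin (n - η) ⊕ Fin η) ℝ)
    (hVl : Vᵀ * V = 1) (hVr : V * Vᵀ = 1)
    (hVspan : LinearMap.range (V.submatrix id Sum.inr).mulVecLin =
      Submodule.map (A0⁻¹ * B).mulVecLin (LinearMap.ker R.mulVecLin))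
    (AV QV : Matrix (Fin (n - η) ⊕ Fin η) (Fin (n - η) ⊕ Fin η) ℝ)
    (hAV : AV = Vᵀ * A0 * V) (hQV : QV = Vᵀ * Q0 * V)
    (BV : Matrix (Fin (n - η) ⊕ Fin η) (Fin m) ℝ) (hBV : BV = Vᵀ * B)
    (Q1 : Matrix (Fin (n - η)) (Fin (n - η)) ℝ) (hQ1 : Q1 = (AVᵀ * QV * AV).toBlocks₁₁)
    (S1 : Matrix (Fin (n - η)) (Fin m) ℝ) (hS1 : S1 = (AVᵀ * QV * BV).submatrix Sum.inl id)
    (R1 : Matrix (Fin m) (Fin m) ℝ) (hR1 : R1 = R + Bᵀ * Q0 * B)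
    : (fromBlocks Q1 S1 S1ᵀ R1).PosSemidef := by
  have hQ0psd : Q0.PosSemidef := hQ0 ▸ posSemidef_generalized_schur hR hPi hRd
  have hRpsd : R.PosSemidef := hPi.submatrix Sum.inr
  have hQ0t : Q0ᵀ = Q0 := by
    simpa [conjTranspose_eq_transpose_of_trivial] using hQ0psd.isHermitian.eq
  set V1 : Matrix (Fin n) (Fin (n - η)) ℝ := V.submatrix id Sum.inl
  have cancel : ∀ {q : Type} (M : Matrix (Fin n) q ℝ), V * (Vᵀ * M) = M := fun M => by
    rw [← Matrix.mul_assoc, hVr, Matrix.one_mul]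
  have eQ : Q1 = (A0 * V1)ᵀ * Q0 * (A0 * V1) := by
    have : AVᵀ * QV * AV = Vᵀ * (A0ᵀ * Q0 * A0 * V) := by
      subst hAV hQV
      simp only [Matrix.transpose_mul, Matrix.transpose_transpose, Matrix.mul_assoc, cancel]
    rw [hQ1, this]
    simp only [Matrix.transpose_mul, Matrix.mul_assoc]
    rfl
  have eS : S1 = (A0 * V1)ᵀ * Q0 * B := by
    have : AVᵀ * QV * BV = Vᵀ * (A0ᵀ * Q0 * B) := by
      subst hAV hQV hBV
      simp only [Matrix.transpose_mul, Matrix.transpose_transpose, Matrix.mul_assoc, cancel]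
    rw [hS1, this]
    simp only [Matrix.transpose_mul, Matrix.mul_assoc]
    rfl
  have h := (hQ0psd.conjTranspose_mul_mul_same (fromCols (A0 * V1) B)).add
    (hRpsd.conjTranspose_mul_mul_same (fromCols (0 : Matrix (Fin m) (Fin (n - η)) ℝ) 1))
  convert h using 1
  rw [conjTranspose_eq_transpose_of_trivial, conjTranspose_eq_transpose_of_trivial,
    transpose_fromCols, transpose_fromCols, fromRows_mul, fromRows_mul_fromCols,
    fromRows_mul, fromRows_mul_fromCols, fromBlocks_add, eQ, eS, hR1]
  simp [Matrix.transpose_mul, hQ0t, Matrix.mul_assoc, add_comm]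
end

section
/- If Δ₁ ∈ ℝ^{(n−η)×(n−η)} is a symmetric solution of the reduced equation CGDARE(Σ₁), then X = V · [[Δ₁ + Q₁₁, Q₁₂], [Q₁₂ᵀ, Q₂₂]] · Vᵀ is a symmetric solution of CGDARE(Σ). -/
open Matrix

/-- The kernel of the corner block `R` of a positive semidefinite block matrix lies in the kernel
of the off-diagonal block. -/
theorem Matrix.PosSemidef.ker_fromBlocks₂₂_le {p q : ℕ} {Q : Matrix (Fin p) (Fin p) ℝ}
    {S : Matrix (Fin p) (Fin q) ℝ} {R : Matrix (Fin q) (Fin q) ℝ}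
    (h : (fromBlocks Q S Sᵀ R).PosSemidef) :
    LinearMap.ker R.mulVecLin ≤ LinearMap.ker S.mulVecLin := by
  intro w hw
  rw [LinearMap.mem_ker, mulVecLin_apply] at hw ⊢
  have h0 := (h.dotProduct_mulVec_zero_iff (Sum.elim 0 w)).1 (by
    simp [fromBlocks_mulVec, hw, dotProduct])
  simp only [fromBlocks_mulVec, Sum.elim_comp_inl, Sum.elim_comp_inr, mulVec_zero, zero_add] at h0
  funext i
  exact congrFun h0 (Sum.inl i)

theorem Matrix.mul_eq_zero_of_ker_le {p q r s : Type*} [Fintype q] [Fintype s]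
    {M : Matrix p q ℝ} {N : Matrix r q ℝ} {K : Matrix q s ℝ}
    (h : LinearMap.ker N.mulVecLin ≤ LinearMap.ker M.mulVecLin) (hK : N * K = 0) : M * K = 0 := by
  classical
  refine ext_of_mulVec_single fun j => ?_
  have hj : K *ᵥ Pi.single j 1 ∈ LinearMap.ker N.mulVecLin := by
    rw [LinearMap.mem_ker, mulVecLin_apply, mulVec_mulVec, hK, zero_mulVec]
  have := h hj
  rw [LinearMap.mem_ker, mulVecLin_apply, mulVec_mulVec] at this
  rw [this, zero_mulVec]

/-- If `ker N ≤ ker M`, then any generalized inverse `G` of `N` satisfies `M G N = M`. -/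
theorem Matrix.mul_inner_inverse_of_ker_le {p q r : Type*} [Fintype q] [Fintype r]
    {M : Matrix p q ℝ} {N : Matrix r q ℝ} {G : Matrix q r ℝ}
    (h : LinearMap.ker N.mulVecLin ≤ LinearMap.ker M.mulVecLin) (hG : N * G * N = N) :
    M * (G * N) = M := by
  classical
  have h0 : M * (1 - G * N) = 0 := mul_eq_zero_of_ker_le h (by
    rw [Matrix.mul_sub, Matrix.mul_one, ← Matrix.mul_assoc, hG, sub_self])
  rw [Matrix.mul_sub, Matrix.mul_one, sub_eq_zero] at h0
  exact h0.symm

/-- A matrix whose range is contained in the image of `ker R` under `C` factors as `C K` with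
`R K = 0`. -/
theorem Matrix.exists_factor_of_range_le_map_ker {p q r s : Type*} [Fintype q] [Fintype r]
    [DecidableEq r] {W : Matrix p r ℝ} {C : Matrix p q ℝ} {R : Matrix s q ℝ}
    (h : LinearMap.range W.mulVecLin ≤ Submodule.map C.mulVecLin (LinearMap.ker R.mulVecLin)) :
    ∃ K : Matrix q r ℝ, R * K = 0 ∧ W = C * K := by
  have hcol : ∀ j, ∃ k, R *ᵥ k = 0 ∧ C *ᵥ k = W *ᵥ Pi.single j 1 := fun j => by
    obtain ⟨k, hk, hk'⟩ := h ⟨Pi.single j 1, rfl⟩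
    exact ⟨k, hk, hk'⟩
  choose k hk hk' using hcol
  refine ⟨of fun i j => k j i, ?_, ?_⟩
  · ext i j
    exact congrFun (hk j) i
  · ext i j
    have := congrFun (hk' j) i
    rw [mulVec_single_one] at this
    exact this.symm

/-- Feedback elimination of the cross term: the Riccati map of `(A, B, Q, S, R)` at `X` equals
that of `(A₀, B, Q₀, 0, R)`. -/
theorem riccati_eq_of_feedback {p q : Type*} [Fintype p] [Fintype q]
    {A A0 Q Q0 X : Matrix p p ℝ} {B S : Matrix p q ℝ} {R Rd N G : Matrix q q ℝ}
    (hA0 : A0 = A - B * Rd * Sᵀ) (hQ0 : Q0 = Q - S * Rd * Sᵀ) (hX : Xᵀ = X) (hN : Nᵀ = N)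
    (hNdef : R + Bᵀ * X * B = N) (hS : S * (Rdᵀ * R) = S)
    (h1 : A0ᵀ * X * B * (G * N) = A0ᵀ * X * B) (h2 : A0ᵀ * X * B * (Gᵀ * N) = A0ᵀ * X * B)
    (hG : N * G * N = N) :
    Aᵀ * X * B + S = A0ᵀ * X * B + S * Rdᵀ * N ∧
    Aᵀ * X * A - (Aᵀ * X * B + S) * G * (Aᵀ * X * B + S)ᵀ + Q =
      A0ᵀ * X * A0 - A0ᵀ * X * B * G * (A0ᵀ * X * B)ᵀ + Q0 := by
  have hA : A = A0 + B * (S * Rdᵀ)ᵀ := by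
    rw [hA0, transpose_mul, transpose_transpose, ← Matrix.mul_assoc, sub_add_cancel]
  have hQ : Q = Q0 + S * Rdᵀ * R * (S * Rdᵀ)ᵀ := by
    rw [Matrix.mul_assoc S, hS, hQ0, transpose_mul, transpose_transpose, ← Matrix.mul_assoc,
      sub_add_cancel]
  have hS' : S * Rdᵀ * R = S := by rw [Matrix.mul_assoc, hS]
  clear hA0 hQ0 hS
  generalize S * Rdᵀ = T at *
  have hSX : Aᵀ * X * B + S = A0ᵀ * X * B + T * N := by
    rw [hA, ← hNdef, transpose_add, transpose_mul, transpose_transpose, ← hS']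
    simp only [Matrix.add_mul, Matrix.mul_add, Matrix.mul_assoc, hS']
    abel
  refine ⟨hSX, ?_⟩
  have h3 : N * G * (A0ᵀ * X * B)ᵀ = (A0ᵀ * X * B)ᵀ := by
    have := congrArg transpose h2
    rwa [transpose_mul, transpose_mul, transpose_transpose, hN] at this
  have hAXA : Aᵀ * X * A = A0ᵀ * X * A0 + A0ᵀ * X * B * Tᵀ + T * (A0ᵀ * X * B)ᵀ
      + T * (N - R) * Tᵀ := by
    rw [hA, ← hNdef, add_sub_cancel_left]
    simp only [transpose_add, transpose_mul, transpose_transpose, hX, Matrix.add_mul,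
      Matrix.mul_add, Matrix.mul_assoc]
    abel
  rw [hSX, hAXA, hQ, transpose_add, transpose_mul T, hN]
  generalize A0ᵀ * X * B = P at *
  have e : (P + T * N) * G * (Pᵀ + N * Tᵀ)
      = P * G * Pᵀ + P * (G * N) * Tᵀ + T * (N * G * Pᵀ) + T * (N * G * N) * Tᵀ := by
    simp only [Matrix.add_mul, Matrix.mul_add, Matrix.mul_assoc]
    abel
  rw [e, h1, h3, hG, Matrix.mul_sub, Matrix.sub_mul]
  abel

/-- A matrix annihilated on both sides by the second part of an orthogonal decomposition is
determined by its compression to the first part. -/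
theorem eq_compression_of_annihilated {p r s : Type*} [Fintype p] [DecidableEq p] [Fintype r]
    [Fintype s] {F : Matrix p p ℝ} {V₁ : Matrix p r ℝ} {V₂ : Matrix p s ℝ}
    (hV : V₁ * V₁ᵀ + V₂ * V₂ᵀ = 1) (hr : F * V₂ = 0) (hl : V₂ᵀ * F = 0) :
    F = V₁ * (V₁ᵀ * F * V₁) * V₁ᵀ := by
  have e1 : F = F * (V₁ * V₁ᵀ) := by
    conv_lhs => rw [← Matrix.mul_one F, ← hV, Matrix.mul_add, ← Matrix.mul_assoc F V₂, hr,
      Matrix.zero_mul, add_zero]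
  have e2 : F = V₁ * V₁ᵀ * F := by
    conv_lhs => rw [← Matrix.one_mul F, ← hV, Matrix.add_mul, Matrix.mul_assoc V₂, hl,
      Matrix.mul_zero, add_zero]
  calc F = V₁ * V₁ᵀ * (F * (V₁ * V₁ᵀ)) := by rw [← e1, ← e2]
    _ = _ := by simp only [Matrix.mul_assoc]

/-- If the compression to the range of `V₁` of the Riccati map at `X` equals `D`, and `A₀` maps the
complementary range of `V₂` into the image of `ker R` under `B`, then the full Riccati map at `X`
equals `V₁ D V₁ᵀ`. -/
theorem riccati_eq_of_compression {p q r s : Type*} [Fintype p] [DecidableEq p] [Fintype q]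
    [Fintype r] [Fintype s] {V₁ : Matrix p r ℝ} {V₂ : Matrix p s ℝ} {A0 X : Matrix p p ℝ}
    {B : Matrix p q ℝ} {K : Matrix q s ℝ} {R N G G' : Matrix q q ℝ} {D : Matrix r r ℝ}
    (hV : V₁ * V₁ᵀ + V₂ * V₂ᵀ = 1) (hAV2 : A0 * V₂ = B * K) (hRK : R * K = 0) (hR : Rᵀ = R)
    (hX : Xᵀ = X) (hNdef : R + Bᵀ * X * B = N)
    (hker1 : LinearMap.ker N.mulVecLin ≤ LinearMap.ker (V₁ᵀ * (A0ᵀ * X * B)).mulVecLin)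
    (hG : N * G * N = N) (hG' : N * G' * N = N)
    (heq : D = V₁ᵀ * (A0ᵀ * X * A0) * V₁ -
      V₁ᵀ * (A0ᵀ * X * B) * G' * (V₁ᵀ * (A0ᵀ * X * B))ᵀ) :
    LinearMap.ker N.mulVecLin ≤ LinearMap.ker (A0ᵀ * X * B).mulVecLin ∧
    A0ᵀ * X * A0 - A0ᵀ * X * B * G * (A0ᵀ * X * B)ᵀ = V₁ * D * V₁ᵀ := by
  have hN : Nᵀ = N := by
    rw [← hNdef]
    simp only [transpose_add, transpose_mul, transpose_transpose, hX, hR, Matrix.mul_assoc]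
  have hKR : Kᵀ * R = 0 := by
    simpa [transpose_mul, hR] using congrArg transpose hRK
  have hVA2 : V₂ᵀ * A0ᵀ = Kᵀ * Bᵀ := by
    rw [← transpose_mul, hAV2, transpose_mul]
  have hNK : Bᵀ * X * B * K = N * K := by rw [← hNdef, Matrix.add_mul, hRK, zero_add]
  have hKN : Kᵀ * (Bᵀ * X * B) = Kᵀ * N := by rw [← hNdef, Matrix.mul_add, hKR, zero_add]
  have hV2P : V₂ᵀ * (A0ᵀ * X * B) = Kᵀ * N := by
    rw [← hKN, ← Matrix.mul_assoc, ← Matrix.mul_assoc, hVA2]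
    simp only [Matrix.mul_assoc]
  have hker : LinearMap.ker N.mulVecLin ≤ LinearMap.ker (A0ᵀ * X * B).mulVecLin := by
    intro w hw
    have hw1 := hker1 hw
    rw [LinearMap.mem_ker, mulVecLin_apply] at hw hw1 ⊢
    have hw2 : (V₂ᵀ * (A0ᵀ * X * B)) *ᵥ w = 0 := by
      rw [hV2P, ← mulVec_mulVec, hw, mulVec_zero]
    rw [← Matrix.one_mul (A0ᵀ * X * B), ← hV, Matrix.add_mul, Matrix.mul_assoc V₁,
      Matrix.mul_assoc V₂, add_mulVec, ← mulVec_mulVec, hw1, ← mulVec_mulVec, hw2,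
      mulVec_zero, mulVec_zero, add_zero]
  have hGT : N * Gᵀ * N = N := by
    simpa [transpose_mul, hN, Matrix.mul_assoc] using congrArg transpose hG
  have h1 := mul_inner_inverse_of_ker_le hker hG
  have h3 : N * G * (A0ᵀ * X * B)ᵀ = (A0ᵀ * X * B)ᵀ := by
    have := congrArg transpose (mul_inner_inverse_of_ker_le hker hGT)
    rwa [transpose_mul, transpose_mul, transpose_transpose, hN] at this
  have hP : A0ᵀ * X * B * G' * (A0ᵀ * X * B)ᵀ = A0ᵀ * X * B * G * (A0ᵀ * X * B)ᵀ := by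
    calc _ = A0ᵀ * X * B * G' * (N * G * (A0ᵀ * X * B)ᵀ) := by rw [h3]
      _ = A0ᵀ * X * B * (G' * N) * G * (A0ᵀ * X * B)ᵀ := by simp only [Matrix.mul_assoc]
      _ = _ := by rw [mul_inner_inverse_of_ker_le hker hG']
  refine ⟨hker, ?_⟩
  have hPT : (A0ᵀ * X * B)ᵀ = Bᵀ * X * A0 := by
    simp only [transpose_mul, transpose_transpose, hX, Matrix.mul_assoc]
  have hr : (A0ᵀ * X * A0 - A0ᵀ * X * B * G * (A0ᵀ * X * B)ᵀ) * V₂ = 0 := by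
    have e : A0ᵀ * X * B * G * (A0ᵀ * X * B)ᵀ * V₂ = A0ᵀ * X * B * K := by
      calc _ = A0ᵀ * X * B * G * (Bᵀ * X * (A0 * V₂)) := by
            rw [hPT]; simp only [Matrix.mul_assoc]
        _ = A0ᵀ * X * B * G * (Bᵀ * X * B * K) := by
            rw [hAV2]; simp only [Matrix.mul_assoc]
        _ = A0ᵀ * X * B * (G * N) * K := by
            rw [hNK]; simp only [Matrix.mul_assoc]
        _ = _ := by rw [h1]
    rw [Matrix.sub_mul, e, Matrix.mul_assoc _ A0, hAV2, ← Matrix.mul_assoc, sub_self]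
  have hl : V₂ᵀ * (A0ᵀ * X * A0 - A0ᵀ * X * B * G * (A0ᵀ * X * B)ᵀ) = 0 := by
    have e : V₂ᵀ * (A0ᵀ * X * B * G * (A0ᵀ * X * B)ᵀ) = Kᵀ * (Bᵀ * X * A0) := by
      calc _ = V₂ᵀ * (A0ᵀ * X * B) * G * (A0ᵀ * X * B)ᵀ := by
            simp only [Matrix.mul_assoc]
        _ = Kᵀ * (N * G * (A0ᵀ * X * B)ᵀ) := by
            rw [hV2P]; simp only [Matrix.mul_assoc]
        _ = _ := by rw [h3, hPT]
    rw [Matrix.mul_sub, e, ← Matrix.mul_assoc, ← Matrix.mul_assoc, hVA2, sub_eq_zero]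
    simp only [Matrix.mul_assoc]
  have hD : V₁ᵀ * (A0ᵀ * X * A0 - A0ᵀ * X * B * G * (A0ᵀ * X * B)ᵀ) * V₁ = D := by
    conv_rhs => rw [heq]
    rw [← hP, transpose_mul V₁ᵀ, transpose_transpose]
    simp only [Matrix.mul_sub, Matrix.sub_mul, Matrix.mul_assoc]
  rw [eq_compression_of_annihilated hV hr hl, hD]

/-- If `Δ₁` is a symmetric solution of the reduced equation
CGDARE(Σ₁), then `X = V [[Δ₁ + Q₁₁, Q₁₂], [Q₁₂ᵀ, Q₂₂]] Vᵀ` is a symmetric solution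
of CGDARE(Σ). -/
theorem stmt18 {n m η : ℕ} (hn : 0 < n) (hm : 0 < m)
    (A : Matrix (Fin n) (Fin n) ℝ) (B : Matrix (Fin n) (Fin m) ℝ)
    (Q : Matrix (Fin n) (Fin n) ℝ) (S : Matrix (Fin n) (Fin m) ℝ)
    (R : Matrix (Fin m) (Fin m) ℝ)
    (hQ : Qᵀ = Q) (hR : Rᵀ = R)
    (hPi : (fromBlocks Q S Sᵀ R).PosSemidef)
    (Rd : Matrix (Fin m) (Fin m) ℝ) (hRd : IsMP R Rd)
    (A0 Q0 : Matrix (Fin n) (Fin n) ℝ)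
    (hA0 : A0 = A - B * Rd * Sᵀ) (hQ0 : Q0 = Q - S * Rd * Sᵀ)
    (hA0inv : IsUnit A0)
    (heta : η = Module.finrank ℝ
      (Submodule.map (A0⁻¹ * B).mulVecLin (LinearMap.ker R.mulVecLin)))
    (V : Matrix (Fin n) (Fin (n - η) ⊕ Fin η) ℝ)
    (hVl : Vᵀ * V = 1) (hVr : V * Vᵀ = 1)
    (hVspan : LinearMap.range (V.submatrix id Sum.inr).mulVecLin =
      Submodule.map (A0⁻¹ * B).mulVecLin (LinearMap.ker R.mulVecLin))
    (AV QV : Matrix (Fin (n - η) ⊕ Fin η) (Fin (n - η) ⊕ Fin η) ℝ)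
    (hAV : AV = Vᵀ * A0 * V) (hQV : QV = Vᵀ * Q0 * V)
    (BV : Matrix (Fin (n - η) ⊕ Fin η) (Fin m) ℝ) (hBV : BV = Vᵀ * B)
    (Q1 : Matrix (Fin (n - η)) (Fin (n - η)) ℝ) (hQ1 : Q1 = (AVᵀ * QV * AV).toBlocks₁₁)
    (S1 : Matrix (Fin (n - η)) (Fin m) ℝ) (hS1 : S1 = (AVᵀ * QV * BV).submatrix Sum.inl id)
    (R1 : Matrix (Fin m) (Fin m) ℝ) (hR1 : R1 = R + Bᵀ * Q0 * B)
    (A1 : Matrix (Fin (n - η)) (Fin (n - η)) ℝ)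
    (hA1 : A1 = (V.submatrix id Sum.inl)ᵀ * A0 * V.submatrix id Sum.inl)
    (B1 : Matrix (Fin (n - η)) (Fin m) ℝ) (hB1 : B1 = (V.submatrix id Sum.inl)ᵀ * B)
    (D1 : Matrix (Fin (n - η)) (Fin (n - η)) ℝ) (hD1sym : D1ᵀ = D1)
    (RD1d : Matrix (Fin m) (Fin m) ℝ) (hRD1d : IsMP (R1 + B1ᵀ * D1 * B1) RD1d)
    (heq1 : D1 = A1ᵀ * D1 * A1 - (A1ᵀ * D1 * B1 + S1) * RD1d * (B1ᵀ * D1 * A1 + S1ᵀ) + Q1)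
    (hker1 : LinearMap.ker (R1 + B1ᵀ * D1 * B1).mulVecLin ≤
      LinearMap.ker (S1 + A1ᵀ * D1 * B1).mulVecLin)
    (X : Matrix (Fin n) (Fin n) ℝ)
    (hXdef : X = V * fromBlocks (D1 + QV.toBlocks₁₁) QV.toBlocks₁₂
      (QV.toBlocks₁₂)ᵀ QV.toBlocks₂₂ * Vᵀ)
    (RXd : Matrix (Fin m) (Fin m) ℝ) (hRXd : IsMP (R + Bᵀ * X * B) RXd) :
    Xᵀ = X ∧
    X = Aᵀ * X * A - (Aᵀ * X * B + S) * RXd * (Aᵀ * X * B + S)ᵀ + Q ∧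
    LinearMap.ker (R + Bᵀ * X * B).mulVecLin ≤
      LinearMap.ker (Aᵀ * X * B + S).mulVecLin := by
  obtain ⟨V₁, hV₁⟩ : ∃ V₁, V.submatrix id Sum.inl = V₁ := ⟨_, rfl⟩
  obtain ⟨V₂, hV₂⟩ : ∃ V₂, V.submatrix id Sum.inr = V₂ := ⟨_, rfl⟩
  rw [hV₁] at hA1 hB1
  rw [hV₂] at hVspan
  have hV : V₁ * V₁ᵀ + V₂ * V₂ᵀ = 1 := by
    rw [← hVr]
    ext i j
    simp [← hV₁, ← hV₂, Matrix.mul_apply, Fintype.sum_sum_type]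
  have cancel : ∀ {k : ℕ} (M : Matrix (Fin n) (Fin k) ℝ), V * (Vᵀ * M) = M := fun M => by
    rw [← Matrix.mul_assoc, hVr, Matrix.one_mul]
  have hkerR := hPi.ker_fromBlocks₂₂_le
  have hRdT : R * Rdᵀ * R = R := by
    simpa [transpose_mul, hR, Matrix.mul_assoc] using congrArg transpose hRd.1
  have hS : S * (Rdᵀ * R) = S := mul_inner_inverse_of_ker_le hkerR hRdT
  have hSd : S * Rd * Sᵀ = S * Rdᵀ * Sᵀ := by
    have h1 : R * Rd * Sᵀ = Sᵀ := by
      simpa [transpose_mul, hR, Matrix.mul_assoc] using congrArg transpose hS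
    calc S * Rd * Sᵀ = S * (Rdᵀ * R) * Rd * Sᵀ := by rw [hS]
      _ = S * Rdᵀ * (R * Rd * Sᵀ) := by simp only [Matrix.mul_assoc]
      _ = _ := by rw [h1]
  have hQ0sym : Q0ᵀ = Q0 := by
    rw [hQ0, transpose_sub, hQ, transpose_mul, transpose_mul, transpose_transpose,
      ← Matrix.mul_assoc, hSd]
  have hQVsym : QVᵀ = QV := by
    rw [hQV, transpose_mul, transpose_mul, transpose_transpose, hQ0sym, Matrix.mul_assoc]
  have hX : X = V₁ * D1 * V₁ᵀ + Q0 := by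
    have hblk : fromBlocks (D1 + QV.toBlocks₁₁) QV.toBlocks₁₂ (QV.toBlocks₁₂)ᵀ QV.toBlocks₂₂
        = fromBlocks D1 0 0 0 + QV := by
      have h21 : (QV.toBlocks₁₂)ᵀ = QV.toBlocks₂₁ := by
        ext i j
        exact congrFun₂ hQVsym (Sum.inr i) (Sum.inl j)
      conv_rhs => rw [← fromBlocks_toBlocks QV, fromBlocks_add]
      rw [h21, zero_add, zero_add, zero_add]
    have hD : V * (fromBlocks D1 0 0 0 : Matrix (Fin (n - η) ⊕ Fin η) (Fin (n - η) ⊕ Fin η) ℝ) * Vᵀ = V₁ * D1 * V₁ᵀ := by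
      ext i j
      simp [← hV₁, Matrix.mul_apply, Fintype.sum_sum_type]
    have hQQ : V * QV * Vᵀ = Q0 := by
      rw [hQV, Matrix.mul_assoc, Matrix.mul_assoc, Matrix.mul_assoc, hVr, Matrix.mul_one, cancel]
    rw [hXdef, hblk, Matrix.mul_add, Matrix.add_mul, hD, hQQ]
  have hXsym : Xᵀ = X := by
    rw [hX, transpose_add, hQ0sym, transpose_mul, transpose_mul, transpose_transpose, hD1sym,
      Matrix.mul_assoc]
  have hN1 : R1 + B1ᵀ * D1 * B1 = R + Bᵀ * X * B := by
    rw [hR1, hB1, hX]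
    simp only [transpose_mul, transpose_transpose, Matrix.mul_add, Matrix.add_mul,
      Matrix.mul_assoc]
    abel
  rw [hN1] at hRD1d hker1
  have hNsym : (R + Bᵀ * X * B)ᵀ = R + Bᵀ * X * B := by
    simp only [transpose_add, transpose_mul, transpose_transpose, hXsym, hR, Matrix.mul_assoc]
  have hS1' : A1ᵀ * D1 * B1 + S1 = V₁ᵀ * (A0ᵀ * X * B) := by
    have : S1 = V₁ᵀ * (A0ᵀ * Q0 * B) := by
      have h : AVᵀ * QV * BV = Vᵀ * (A0ᵀ * Q0 * B) := by
        rw [hAV, hQV, hBV]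
        simp only [transpose_mul, transpose_transpose, Matrix.mul_assoc, cancel]
      rw [hS1, h, ← hV₁]
      rfl
    rw [this, hA1, hB1, hX]
    simp only [transpose_mul, transpose_transpose, Matrix.mul_add, Matrix.add_mul,
      Matrix.mul_assoc]
  have hQ1' : A1ᵀ * D1 * A1 + Q1 = V₁ᵀ * (A0ᵀ * X * A0) * V₁ := by
    have : Q1 = V₁ᵀ * (A0ᵀ * Q0 * A0) * V₁ := by
      have h : AVᵀ * QV * AV = Vᵀ * (A0ᵀ * Q0 * A0) * V := by
        rw [hAV, hQV]
        simp only [transpose_mul, transpose_transpose, Matrix.mul_assoc]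
        simp only [← Matrix.mul_assoc V, hVr, Matrix.one_mul]
      rw [hQ1, h, ← hV₁]
      rfl
    rw [this, hA1, hX]
    simp only [transpose_mul, transpose_transpose, Matrix.mul_add, Matrix.add_mul,
      Matrix.mul_assoc]
  have hS1T : B1ᵀ * D1 * A1 + S1ᵀ = (V₁ᵀ * (A0ᵀ * X * B))ᵀ := by
    rw [← hS1']
    simp only [transpose_add, transpose_mul, transpose_transpose, hD1sym, Matrix.mul_assoc]
  rw [add_comm S1, hS1'] at hker1
  rw [hS1T, hS1', sub_add_eq_add_sub, hQ1'] at heq1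
  obtain ⟨K, hRK, hK⟩ := exists_factor_of_range_le_map_ker hVspan.le
  have hAV2 : A0 * V₂ = B * K := by
    rw [hK, Matrix.mul_assoc, mul_nonsing_inv_cancel_left _ _ ((isUnit_iff_isUnit_det A0).1 hA0inv)]
  obtain ⟨N, hNdef⟩ : ∃ N, R + Bᵀ * X * B = N := ⟨_, rfl⟩
  rw [hNdef] at hRXd hker1 hNsym hRD1d ⊢
  obtain ⟨hker, hD⟩ := riccati_eq_of_compression hV hAV2 hRK hR hXsym hNdef hker1 hRXd.1 hRD1d.1
    heq1
  have hGT : N * RXdᵀ * N = N := by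
    simpa [transpose_mul, hNsym, Matrix.mul_assoc] using congrArg transpose hRXd.1
  obtain ⟨hSX, hric⟩ := riccati_eq_of_feedback (A := A) hA0 hQ0 hXsym hNsym hNdef hS
    (mul_inner_inverse_of_ker_le hker hRXd.1) (mul_inner_inverse_of_ker_le hker hGT) hRXd.1
  refine ⟨hXsym, ?_, ?_⟩
  · rw [hric, hD, hX]
  · rw [hSX]
    intro w hw
    have hw1 := hker hw
    rw [LinearMap.mem_ker, mulVecLin_apply] at hw hw1 ⊢
    rw [add_mulVec, hw1, ← mulVec_mulVec, hw, mulVec_zero, add_zero]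
end
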